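/- arXiv:1701.06686 — 2 statements merged into one kernel-verified Lean document; each statement's English description precedes it below -/
import Mathlib

section
/- Let q_V(x_V | x_W) be a kernel with V = R ∪̇ H ∪̇ T and let q*_{V∖H}(x_R, x_T | x_H, x_W) = q_V(x_R, x_H, x_T | x_W)/q_V(x_H | x_T, x_W). Then q*_{V∖H}(x_R, x_T | x_H, x_W) = q_V(x_R | x_H, x_T, x_W) · q_V(x_T | x_W); consequently q*_{V∖H}(x_R | x_H, x_T, x_W) = q_V(x_R | x_H, x_T, x_W), and q*_{V∖H}(x_T | x_W) = q*_{V∖H}(x_T | x_H, x_W) = q_V(x_T | x_W). -/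
open scoped Classical
open Finset

namespace Nested

/-- A directed mixed graph: directed (`dir`) and bidirected (`bi`) edges. -/
structure MixedGraph (Vt : Type) where
  dir : Vt → Vt → Prop
  bi : Vt → Vt → Prop

/-- A step along a path: an edge traversed from `src` to `tgt`, with Booleans
recording whether there is an arrowhead at the `src` (resp. `tgt`) end. -/
structure Step (Vt : Type) where
  src : Vt
  tgt : Vt
  hsrc : Bool
  htgt : Bool

/-- The step corresponds to an actual edge of the mixed graph `M`. -/
def StepIn {Vt : Type} (M : MixedGraph Vt) (s : Step Vt) : Prop :=
  (s.hsrc = false ∧ s.htgt = true ∧ M.dir s.src s.tgt) ∨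
  (s.hsrc = true ∧ s.htgt = false ∧ M.dir s.tgt s.src) ∨
  (s.hsrc = true ∧ s.htgt = true ∧ M.bi s.src s.tgt)

/-- `IsWalk M a p b`: `p` is a walk in `M` from `a` to `b`. -/
def IsWalk {Vt : Type} (M : MixedGraph Vt) : Vt → List (Step Vt) → Vt → Prop
  | a, [], b => a = b
  | a, s :: p, b => s.src = a ∧ StepIn M s ∧ IsWalk M s.tgt p b

/-- The list of vertices visited by a walk starting at `a`. -/
def wverts {Vt : Type} (a : Vt) (p : List (Step Vt)) : List Vt :=
  a :: p.map Step.tgt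

/-- The non-endpoint (interior) vertices of a walk. -/
def interiorVerts {Vt : Type} (p : List (Step Vt)) : List Vt :=
  (p.map Step.tgt).dropLast

variable {Vt : Type} [Fintype Vt] [DecidableEq Vt]

/-- `z` is an ancestor (via directed edges) of some element of `C`. -/
def ancOf (M : MixedGraph Vt) (C : Finset Vt) (z : Vt) : Prop :=
  ∃ c ∈ C, Relation.ReflTransGen M.dir z c

/-- The common vertex of two consecutive steps is a collider. -/
def Collider {Vt : Type} (s t : Step Vt) : Prop := s.htgt = true ∧ t.hsrc = true

/-- The interior vertex shared by consecutive steps `s`, `t` satisfies the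
m-connection requirement given `C`: colliders are ancestors of `C`,
non-colliders lie outside `C`. -/
def jointOK (M : MixedGraph Vt) (C : Finset Vt) (s t : Step Vt) : Prop :=
  (Collider s t ∧ ancOf M C s.tgt) ∨ (¬ Collider s t ∧ s.tgt ∉ C)

/-- `a` and `b` are m-connected given `C` in `M`: there is a path (walk with
distinct vertices) from `a` to `b` every non-collider of which avoids `C` and
every collider of which is an ancestor of `C`. -/
def MConn (M : MixedGraph Vt) (C : Finset Vt) (a b : Vt) : Prop :=
  ∃ p : List (Step Vt), IsWalk M a p b ∧ (wverts a p).Nodup ∧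
    List.Chain' (jointOK M C) p

/-- m-separation of the sets `A` and `B` given `C` in `M`. -/
def MSep (M : MixedGraph Vt) (A B C : Finset Vt) : Prop :=
  ∀ a ∈ A, ∀ b ∈ B, ¬ MConn M C a b

/-- There is a directed path from `v` to `w` in `M` all of whose
non-endpoint vertices lie in `L`. -/
def DirVia (M : MixedGraph Vt) (L : Finset Vt) (v w : Vt) : Prop :=
  ∃ p : List (Step Vt), p ≠ [] ∧ IsWalk M v p w ∧ (wverts v p).Nodup ∧
    (∀ s ∈ p, s.hsrc = false ∧ s.htgt = true) ∧
    (∀ z ∈ interiorVerts p, z ∈ L)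

/-- There is a path between `v` and `w` in `M` with arrowheads at both
endpoints, all of whose non-endpoint vertices are non-colliders lying in `L`. -/
def BiVia (M : MixedGraph Vt) (L : Finset Vt) (v w : Vt) : Prop :=
  ∃ p : List (Step Vt), p ≠ [] ∧ IsWalk M v p w ∧ (wverts v p).Nodup ∧
    (∀ s, p.head? = some s → s.hsrc = true) ∧
    (∀ s, p.getLast? = some s → s.htgt = true) ∧
    (∀ z ∈ interiorVerts p, z ∈ L) ∧
    List.Chain' (fun s t => ¬ Collider s t) p

/-- A (pre-)conditional acyclic directed mixed graph: a mixed graph together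
with disjoint finite sets `V` of random and `W` of fixed vertices.  The
well-formedness conditions are collected in `PreCADMG.WF`. -/
structure PreCADMG (Vt : Type) where
  dir : Vt → Vt → Prop
  bi : Vt → Vt → Prop
  V : Finset Vt
  W : Finset Vt

/-- The underlying mixed graph of a CADMG. -/
def PreCADMG.mg {Vt : Type} (G : PreCADMG Vt) : MixedGraph Vt := ⟨G.dir, G.bi⟩

/-- Well-formedness: `V` and `W` are disjoint, `bi` is symmetric, all edges
join vertices of `V ∪ W`, directed and bidirected edges never point into `W`,
and there are no directed cycles.  (So `WF` with `W = ∅` says: ADMG.) -/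
def PreCADMG.WF {Vt : Type} (G : PreCADMG Vt) : Prop :=
  Disjoint G.V G.W ∧
  (∀ a b, G.bi a b → G.bi b a) ∧
  (∀ a b, G.dir a b → a ∈ G.V ∪ G.W ∧ b ∈ G.V) ∧
  (∀ a b, G.bi a b → a ∈ G.V ∧ b ∈ G.V) ∧
  (∀ v, ¬ Relation.TransGen G.dir v v)

/-- The district of `v`: random vertices joined to `v` by a bidirected path. -/
noncomputable def dis (G : PreCADMG Vt) (v : Vt) : Finset Vt :=
  G.V.filter (fun w => Relation.ReflTransGen G.bi v w)

/-- The set of districts of `G`. -/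
noncomputable def districts (G : PreCADMG Vt) : Finset (Finset Vt) :=
  G.V.image (dis G)

/-- Descendants of `v` (including `v` itself, among the vertices of `G`). -/
noncomputable def deF (G : PreCADMG Vt) (v : Vt) : Finset Vt :=
  (G.V ∪ G.W).filter (fun w => Relation.ReflTransGen G.dir v w)

/-- Non-descendants of `v`. -/
noncomputable def ndF (G : PreCADMG Vt) (v : Vt) : Finset Vt :=
  (G.V ∪ G.W) \ deF G v

/-- Ancestors of the set `D` (including `D`). -/
noncomputable def anS (G : PreCADMG Vt) (D : Finset Vt) : Finset Vt :=
  (G.V ∪ G.W).filter (fun a => ∃ d ∈ D, Relation.ReflTransGen G.dir a d)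

/-- Parents of the set `D`. -/
noncomputable def paS (G : PreCADMG Vt) (D : Finset Vt) : Finset Vt :=
  (G.V ∪ G.W).filter (fun a => ∃ d ∈ D, G.dir a d)

/-- Markov blanket: `mb(t) = pa(dis(t)) ∪ (dis(t) \ {t})`. -/
noncomputable def mb (G : PreCADMG Vt) (t : Vt) : Finset Vt :=
  paS G (dis G t) ∪ (dis G t).erase t

/-- `v` is fixable in `G`: `v` is random and `dis(v) ∩ de(v) = {v}`. -/
def fixable (G : PreCADMG Vt) (v : Vt) : Prop :=
  v ∈ G.V ∧ dis G v ∩ deF G v = {v}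

/-- The set `𝔽(G)` of fixable vertices. -/
noncomputable def FixF (G : PreCADMG Vt) : Finset Vt :=
  G.V.filter (fun v => fixable G v)

/-- The graph `φ_r(G)`:  `r` becomes fixed and edges with an arrowhead at `r`
are deleted. -/
def fixG (G : PreCADMG Vt) (r : Vt) : PreCADMG Vt where
  dir a b := G.dir a b ∧ b ≠ r
  bi a b := G.bi a b ∧ a ≠ r ∧ b ≠ r
  V := G.V.erase r
  W := insert r G.W

/-- The induced subgraph on `A`, preserving random/fixed status. -/
def induce (G : PreCADMG Vt) (A : Finset Vt) : PreCADMG Vt where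
  dir a b := G.dir a b ∧ a ∈ A ∧ b ∈ A
  bi a b := G.bi a b ∧ a ∈ A ∧ b ∈ A
  V := G.V ∩ A
  W := G.W ∩ A

/-- `A` is an ancestral set in `G`. -/
def Ancestral (G : PreCADMG Vt) (A : Finset Vt) : Prop :=
  A ⊆ G.V ∪ G.W ∧
  ∀ a ∈ A, ∀ b ∈ G.V ∪ G.W, Relation.ReflTransGen G.dir b a → b ∈ A

/-- `ord` is (the rank function of) a topological total ordering for `G`:
if `a ≺ b` then `a` is not a descendant of `b`. -/
def IsTopo (G : PreCADMG Vt) (ord : Vt → ℕ) : Prop :=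
  Function.Injective ord ∧
  ∀ a b, ord a < ord b → ¬ Relation.ReflTransGen G.dir b a

/-- The predecessors of `d` in the ordering `ord`. -/
noncomputable def preF (G : PreCADMG Vt) (ord : Vt → ℕ) (d : Vt) : Finset Vt :=
  (G.V ∪ G.W).filter (fun a => ord a < ord d)

/-- The graph `G^{|W}`: all pairs of fixed vertices joined by bidirected
edges. -/
def augMG (G : PreCADMG Vt) : MixedGraph Vt :=
  ⟨G.dir, fun a b => G.bi a b ∨ (a ∈ G.W ∧ b ∈ G.W ∧ a ≠ b)⟩

/-- Adjacency in the augmented graph `(G)^a`: joined in `G^{|W}` by a path on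
which every non-endpoint vertex is a collider. -/
def augEdge (G : PreCADMG Vt) (a b : Vt) : Prop :=
  a ≠ b ∧ ∃ p : List (Step Vt), p ≠ [] ∧ IsWalk (augMG G) a p b ∧
    (wverts a p).Nodup ∧ List.Chain' Collider p

/-- Undirected separation of `a` from `b` by `C` (w.r.t. adjacency `E`). -/
def USepPt (E : Vt → Vt → Prop) (C : Finset Vt) (a b : Vt) : Prop :=
  ∀ l : List Vt, l.Chain' E → l.head? = some a → l.getLast? = some b →
    l.Nodup → ∃ v ∈ l, v ∈ C

/-- Undirected separation of `A` from `B` by `C`. -/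
def USep (E : Vt → Vt → Prop) (C A B : Finset Vt) : Prop :=
  ∀ a ∈ A, ∀ b ∈ B, USepPt E C a b

/-- The latent projection of `G` obtained by projecting out the (random)
vertices in `H`. -/
def project (G : PreCADMG Vt) (H : Finset Vt) : PreCADMG Vt where
  dir v w := v ∈ (G.V \ H) ∪ G.W ∧ w ∈ G.V \ H ∧ v ≠ w ∧ DirVia G.mg H v w
  bi v w := v ∈ G.V \ H ∧ w ∈ G.V \ H ∧ v ≠ w ∧ BiVia G.mg H v w
  V := G.V \ H
  W := G.W

/-! ## Kernels -/

variable {𝔛 : Vt → Type} [∀ v, Fintype (𝔛 v)]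

/-- Sum a function of a joint state over all assignments to the coordinates in
`S`, the remaining coordinates being given by `x`. -/
noncomputable def sumOver (S : Finset Vt) (f : (∀ v, 𝔛 v) → ℝ) (x : ∀ v, 𝔛 v) : ℝ :=
  ∑ y : ((v : {v : Vt // v ∈ S}) → 𝔛 v.1),
    f (fun v => if h : v ∈ S then y ⟨v, h⟩ else x v)

/-- `f` depends only on the coordinates in `S`. -/
def DepOn (f : (∀ v, 𝔛 v) → ℝ) (S : Finset Vt) : Prop :=
  ∀ x y : ∀ v, 𝔛 v, (∀ v ∈ S, x v = y v) → f x = f y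

/-- `q` is a kernel `q_V(x_V | x_W)`: a nonnegative function of `(x_V, x_W)`
with `∑_{x_V} q_V(x_V | x_W) = 1` for every `x_W`. -/
def IsKernel (V W : Finset Vt) (q : (∀ v, 𝔛 v) → ℝ) : Prop :=
  (∀ x, 0 ≤ q x) ∧ DepOn q (V ∪ W) ∧ ∀ x, sumOver V q x = 1

/-- Case (a) of the definition of kernel conditional independence
`X_A ⫫ X_B | X_C [q_V]`:  `A ∩ W = ∅` and the conditional kernel
`q_V(x_A | x_B, x_C, x_{W∖(B∪C)})` is, wherever defined, a function of
`x_A, x_C` only. -/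
def KIndepA (V W : Finset Vt) (q : (∀ v, 𝔛 v) → ℝ) (A B C : Finset Vt) : Prop :=
  A ∩ W = ∅ ∧
  ∀ x y : ∀ v, 𝔛 v, (∀ v ∈ A ∪ C, x v = y v) →
    0 < sumOver (V \ (B ∪ C)) q x → 0 < sumOver (V \ (B ∪ C)) q y →
    sumOver (V \ (A ∪ B ∪ C)) q x / sumOver (V \ (B ∪ C)) q x =
      sumOver (V \ (A ∪ B ∪ C)) q y / sumOver (V \ (B ∪ C)) q y

/-- Kernel conditional independence `X_A ⫫ X_B | X_C [q_V]`. -/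
def KIndep (V W : Finset Vt) (q : (∀ v, 𝔛 v) → ℝ) (A B C : Finset Vt) : Prop :=
  KIndepA V W q A B C ∨ KIndepA V W q B A C

/-- The conditional kernel `q_V(x_d | x_T)` (as a function of the joint
state). -/
noncomputable def condOn (V : Finset Vt) (q : (∀ v, 𝔛 v) → ℝ) (d : Vt)
    (T : Finset Vt) : (∀ v, 𝔛 v) → ℝ :=
  fun x => sumOver (V \ insert d T) q x / sumOver (V \ T) q x

/-- The kernel `q*_{V∖H} = q_V / q_V(x_H | x_T, x_W)` obtained by fixing `H`. -/
noncomputable def qstar (V H T : Finset Vt) (q : (∀ v, 𝔛 v) → ℝ) :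
    (∀ v, 𝔛 v) → ℝ :=
  fun x => q x / (sumOver (V \ (H ∪ T)) q x / sumOver (V \ T) q x)

/-- The kernel fixing operation `φ_r(q; G) = q / q_V(x_r | x_{mb_G(r)})`. -/
noncomputable def fixK (G : PreCADMG Vt) (r : Vt) (q : (∀ v, 𝔛 v) → ℝ) :
    (∀ v, 𝔛 v) → ℝ :=
  fun x => q x / condOn G.V q r (mb G r) x

/-- The global Markov property for a CADMG (`q ∈ 𝒫^c_m(G)`). -/
def Pcm (G : PreCADMG Vt) (q : (∀ v, 𝔛 v) → ℝ) : Prop :=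
  ∀ A B C : Finset Vt, A ⊆ G.V ∪ G.W → B ⊆ G.V ∪ G.W → C ⊆ G.V ∪ G.W →
    Disjoint A B → Disjoint A C → Disjoint B C →
    MSep (augMG G) A B C → KIndep G.V G.W q A B C

/-- The augmented Markov property for a CADMG (`q ∈ 𝒫^c_a(G)`). -/
def Pca (G : PreCADMG Vt) (q : (∀ v, 𝔛 v) → ℝ) : Prop :=
  ∀ A B C : Finset Vt, A ⊆ G.V ∪ G.W → B ⊆ G.V ∪ G.W → C ⊆ G.V ∪ G.W →
    Disjoint A B → Disjoint A C → Disjoint B C →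
    USep (augEdge (induce G (anS G (A ∪ B ∪ C)))) C A B →
    KIndep G.V G.W q A B C

/-- The local Markov property for `G` at `t`. -/
def LocalAt (G : PreCADMG Vt) (q : (∀ v, 𝔛 v) → ℝ) (t : Vt) : Prop :=
  KIndep G.V G.W q {t} ((G.V ∪ G.W) \ insert t (mb G t)) (mb G t)

/-- The ordered local Markov property for a CADMG (`q ∈ 𝒫^c_l(G, ≺)`). -/
def Pcl (G : PreCADMG Vt) (ord : Vt → ℕ) (q : (∀ v, 𝔛 v) → ℝ) : Prop :=
  ∀ A : Finset Vt, Ancestral G A → ∀ m ∈ A, (∀ a ∈ A, ord a ≤ ord m) →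
    m ∈ G.V →
    LocalAt (induce G ((G.V ∩ A) ∪ G.W)) (sumOver (G.V \ A) q) m

/-- Tian factorization for a CADMG (`q ∈ 𝒫^c_f(G)`). -/
def Pcf (G : PreCADMG Vt) (q : (∀ v, 𝔛 v) → ℝ) : Prop :=
  ∀ A : Finset Vt, Ancestral G A →
    ∃ f : Finset Vt → ((∀ v, 𝔛 v) → ℝ),
      (∀ D ∈ districts (induce G A), IsKernel D (paS G D \ D) (f D)) ∧
      ∀ x, sumOver (G.V \ A) q x = ∏ D ∈ districts (induce G A), f D x

/-- `T^{(d,D)}_≺ = mb_G(d, an_G(D) ∩ pre_≺(d))`. -/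
noncomputable def Tset (G : PreCADMG Vt) (ord : Vt → ℕ) (d : Vt)
    (D : Finset Vt) : Finset Vt :=
  mb (induce G (insert d (anS G D ∩ preF G ord d))) d

/-- The district kernel
`q_D(x_D | x_{pa(D)∖D}) = ∏_{d ∈ D} q_V(x_d | x_{T^{(d,D)}_≺})`. -/
noncomputable def qD (G : PreCADMG Vt) (ord : Vt → ℕ)
    (q : (∀ v, 𝔛 v) → ℝ) (D : Finset Vt) : (∀ v, 𝔛 v) → ℝ :=
  fun x => ∏ d ∈ D, condOn G.V q d (Tset G ord d D) x

/-! ## Fixing sequences and nested Markov properties -/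

/-- Iterated graph fixing. -/
def fixGs : PreCADMG Vt → List Vt → PreCADMG Vt
  | G, [] => G
  | G, r :: rs => fixGs (fixG G r) rs

/-- Iterated kernel fixing. -/
noncomputable def fixKs : PreCADMG Vt → ((∀ v, 𝔛 v) → ℝ) → List Vt →
    ((∀ v, 𝔛 v) → ℝ)
  | _, q, [] => q
  | G, q, r :: rs => fixKs (fixG G r) (fixK G r q) rs

/-- A valid fixing sequence: each vertex is fixable when its turn comes. -/
def ValidSeq : PreCADMG Vt → List Vt → Prop
  | _, [] => True
  | G, r :: rs => fixable G r ∧ ValidSeq (fixG G r) rs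

/-- The global nested Markov property for an ADMG. -/
def NestedGlobal (G : PreCADMG Vt) (p : (∀ v, 𝔛 v) → ℝ) : Prop :=
  ∀ ws : List Vt, ValidSeq G ws → Pcm (fixGs G ws) (fixKs G p ws)

/-- `C` is intrinsic in `G`: a district of a reachable CADMG. -/
def Intrinsic (G : PreCADMG Vt) (C : Finset Vt) : Prop :=
  ∃ ws : List Vt, ws.Nodup ∧ ValidSeq G ws ∧ C ∈ districts (fixGs G ws)

/-- The ordered local nested Markov property for an ADMG. -/
def NestedLocal (G : PreCADMG Vt) (ord : Vt → ℕ) (p : (∀ v, 𝔛 v) → ℝ) : Prop :=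
  ∀ C : Finset Vt, Intrinsic G C →
    ∀ ws : List Vt, ws.Nodup → ValidSeq G ws → ws.toFinset = G.V \ C →
      ∀ m ∈ C, (∀ c ∈ C, ord c ≤ ord m) →
        LocalAt (fixGs G ws) (fixKs G p ws) m

end Nested

namespace Nested

theorem sumOver_congr_off {Vt : Type} [DecidableEq Vt] {𝔛 : Vt → Type} [∀ v, Fintype (𝔛 v)]
    {S : Finset Vt} (f : (∀ v, 𝔛 v) → ℝ) {x y : ∀ v, 𝔛 v} (h : ∀ v, v ∉ S → x v = y v) :
    sumOver S f x = sumOver S f y := by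
  unfold sumOver
  refine Finset.sum_congr rfl fun z _ => congrArg f (funext fun v => ?_)
  split_ifs with hv
  · rfl
  · exact h v hv

/-- Summing `qstar` over the coordinates that are neither fixed nor in `T` gives the
marginal kernel of `T`. -/
theorem sumOver_qstar {Vt : Type} [DecidableEq Vt] {𝔛 : Vt → Type} [∀ v, Fintype (𝔛 v)]
    (V H T : Finset Vt) (q : (∀ v, 𝔛 v) → ℝ) {x : ∀ v, 𝔛 v}
    (hx : sumOver (V \ (H ∪ T)) q x ≠ 0) :
    sumOver (V \ (H ∪ T)) (qstar V H T q) x = sumOver (V \ T) q x := by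
  have key : sumOver (V \ (H ∪ T)) (qstar V H T q) x
      = sumOver (V \ (H ∪ T)) q x /
        (sumOver (V \ (H ∪ T)) q x / sumOver (V \ T) q x) := by
    conv_lhs => unfold sumOver
    conv_rhs => enter [1]; unfold sumOver
    rw [Finset.sum_div]
    refine Finset.sum_congr rfl fun z _ => ?_
    unfold qstar
    congr 2
    · refine sumOver_congr_off q fun v hv => ?_
      simp only [hv, dite_false]
    · refine sumOver_congr_off q fun v hv => ?_
      have hv' : v ∉ V \ (H ∪ T) := by
        simp only [Finset.mem_sdiff, Finset.mem_union] at hv ⊢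
        tauto
      simp only [hv', dite_false]
  rw [key, div_div_cancel₀ hx]

end Nested

open Nested in
/-- for `V = R ∪̇ H ∪̇ T` and
`q*_{V∖H} = q_V / q_V(x_H | x_T, x_W)` one has, wherever the relevant
denominators are positive:
`q* = q_V(x_R | x_H, x_T, x_W) · q_V(x_T | x_W)`, hence
`q*(x_R | x_H, x_T, x_W) = q_V(x_R | x_H, x_T, x_W)` and
`q*(x_T | x_W) = q*(x_T | x_H, x_W) = q_V(x_T | x_W)`. -/
theorem kernel_construction_identities
    {Vt : Type} [Fintype Vt] [DecidableEq Vt]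
    {𝔛 : Vt → Type} [∀ v, Fintype (𝔛 v)]
    (V W R H T : Finset Vt) (hV : V = R ∪ H ∪ T)
    (hRH : Disjoint R H) (hRT : Disjoint R T) (hHT : Disjoint H T)
    (hVW : Disjoint V W)
    (q : (∀ v, 𝔛 v) → ℝ) (hq : IsKernel V W q) :
    ∀ x : ∀ v, 𝔛 v,
      0 < sumOver (V \ (H ∪ T)) q x → 0 < sumOver (V \ T) q x →
      (qstar V H T q x
          = q x / sumOver (V \ (H ∪ T)) q x * sumOver (V \ T) q x) ∧
      (qstar V H T q x / sumOver ((V \ H) \ T) (qstar V H T q) x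
          = q x / sumOver (V \ (H ∪ T)) q x) ∧
      (sumOver ((V \ H) \ T) (qstar V H T q) x = sumOver (V \ T) q x) ∧
      (∀ y : ∀ v, 𝔛 v, (∀ v, v ∉ H → x v = y v) →
        0 < sumOver (V \ (H ∪ T)) q y →
        sumOver ((V \ H) \ T) (qstar V H T q) y
          = sumOver ((V \ H) \ T) (qstar V H T q) x) := by
  have hset : (V \ H) \ T = V \ (H ∪ T) := sdiff_sdiff_left
  intro x hc hd
  rw [hset, sumOver_qstar V H T q hc.ne']
  refine ⟨?_, ?_, rfl, fun y hxy hy => ?_⟩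
  · unfold qstar
    rw [div_div_eq_mul_div, div_mul_eq_mul_div]
  · unfold qstar
    field_simp
  · rw [sumOver_qstar V H T q hy.ne']
    refine sumOver_congr_off q fun v hv => (hxy v fun hvH => hv ?_).symm
    exact Finset.mem_sdiff.2 ⟨by simp [hV, hvH], Finset.disjoint_left.1 hHT hvH⟩
end

section
/- For any CADMG 𝒢(V,W) and any topological ordering ≺, the four sets of kernels coincide: 𝒫^c_f(𝒢) = 𝒫^c_l(𝒢,≺) = 𝒫^c_m(𝒢) = 𝒫^c_a(𝒢). -/
open scoped Classical
open Finset

namespace Nested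

section SumOver

variable {Vt : Type} {𝔛 : Vt → Type}

theorem DepOn.mono {f : (∀ v, 𝔛 v) → ℝ} {S T : Finset Vt} (hf : DepOn f S) (h : S ⊆ T) :
    DepOn f T :=
  fun x y hxy => hf x y fun v hv => hxy v (h hv)

theorem DepOn.prod {ι : Type*} {s : Finset ι} {f : ι → (∀ v, 𝔛 v) → ℝ} {S : Finset Vt}
    (hf : ∀ i ∈ s, DepOn (f i) S) : DepOn (fun x => ∏ i ∈ s, f i x) S :=
  fun x y hxy => Finset.prod_congr rfl fun i hi => hf i hi x y hxy

variable [DecidableEq Vt] [∀ v, Fintype (𝔛 v)]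

theorem sumOver_empty (f : (∀ v, 𝔛 v) → ℝ) : sumOver ∅ f = f := by
  funext x
  simp [sumOver]

theorem sumOver_sumOver {S T : Finset Vt} (h : Disjoint S T) (f : (∀ v, 𝔛 v) → ℝ) :
    sumOver S (sumOver T f) = sumOver (S ∪ T) f := by
  funext x
  unfold sumOver
  rw [← (Equiv.piFinsetUnion 𝔛 h).sum_comp, Fintype.sum_prod_type]
  refine Finset.sum_congr rfl fun y _ => Finset.sum_congr rfl fun z _ => ?_
  congr 1
  funext v
  by_cases hT : v ∈ T
  · simp [hT, Equiv.piFinsetUnion_right 𝔛 h hT (Finset.mem_union_right S hT)]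
  · by_cases hS : v ∈ S
    · simp [hT, hS, Equiv.piFinsetUnion_left 𝔛 h hS (Finset.mem_union_left T hS)]
    · simp [hT, hS]

theorem sumOver_sumOver_comm {S T : Finset Vt} (h : Disjoint S T) (f : (∀ v, 𝔛 v) → ℝ) :
    sumOver S (sumOver T f) = sumOver T (sumOver S f) := by
  rw [sumOver_sumOver h, sumOver_sumOver h.symm, Finset.union_comm]

theorem sumOver_nonneg {S : Finset Vt} {f : (∀ v, 𝔛 v) → ℝ} (hf : ∀ x, 0 ≤ f x)
    (x : ∀ v, 𝔛 v) : 0 ≤ sumOver S f x :=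
  Finset.sum_nonneg fun _ _ => hf _

theorem DepOn.sumOver {f : (∀ v, 𝔛 v) → ℝ} {S T : Finset Vt} (hf : DepOn f T) :
    DepOn (sumOver S f) (T \ S) := by
  intro x y hxy
  refine Finset.sum_congr rfl fun z _ => hf _ _ fun v hv => ?_
  by_cases hS : v ∈ S
  · simp [hS]
  · simp [hS, hxy v (Finset.mem_sdiff.2 ⟨hv, hS⟩)]

theorem sumOver_congr {S : Finset Vt} {f g : (∀ v, 𝔛 v) → ℝ} {x : ∀ v, 𝔛 v}
    (h : ∀ y : ∀ v, 𝔛 v, (∀ v ∉ S, y v = x v) → f y = g y) : sumOver S f x = sumOver S g x :=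
  Finset.sum_congr rfl fun z _ => h _ fun v hv => by simp [hv]

theorem sumOver_const_mul (S : Finset Vt) (c : ℝ) (f : (∀ v, 𝔛 v) → ℝ) (x : ∀ v, 𝔛 v) :
    sumOver S (fun y => c * f y) x = c * sumOver S f x :=
  (Finset.mul_sum _ _ _).symm

/-- A factor that does not involve the summed coordinates can be pulled out. -/
theorem sumOver_mul_left {S T : Finset Vt} {g : (∀ v, 𝔛 v) → ℝ} (hg : DepOn g T)
    (hST : Disjoint S T) (f : (∀ v, 𝔛 v) → ℝ) (x : ∀ v, 𝔛 v) :
    sumOver S (fun y => g y * f y) x = g x * sumOver S f x := by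
  rw [← sumOver_const_mul]
  refine sumOver_congr fun y hy => ?_
  rw [hg y x fun v hv => hy v (Finset.disjoint_right.1 hST hv)]

theorem sumOver_mul_right {S T : Finset Vt} {g : (∀ v, 𝔛 v) → ℝ} (hg : DepOn g T)
    (hST : Disjoint S T) (f : (∀ v, 𝔛 v) → ℝ) (x : ∀ v, 𝔛 v) :
    sumOver S (fun y => f y * g y) x = sumOver S f x * g x := by
  simp_rw [mul_comm _ (g _)]
  exact sumOver_mul_left hg hST f x

theorem le_sumOver {S : Finset Vt} {f : (∀ v, 𝔛 v) → ℝ} (hf : ∀ x, 0 ≤ f x)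
    (x : ∀ v, 𝔛 v) : f x ≤ sumOver S f x := by
  have h := Finset.single_le_sum
    (f := fun y : ((v : {v : Vt // v ∈ S}) → 𝔛 v.1) =>
      f (fun v => if h : v ∈ S then y ⟨v, h⟩ else x v))
    (fun y _ => hf _) (Finset.mem_univ fun v : {v : Vt // v ∈ S} => x v.1)
  simpa [sumOver] using h

theorem eq_zero_of_sumOver_eq_zero {S : Finset Vt} {f : (∀ v, 𝔛 v) → ℝ} (hf : ∀ x, 0 ≤ f x)
    {x : ∀ v, 𝔛 v} (h : sumOver S f x = 0) : f x = 0 :=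
  le_antisymm (h ▸ le_sumOver hf x) (hf x)

/-- A product of conditional densities, each involving only coordinates that do not come
later in the order, sums to one. -/
theorem sumOver_prod_eq_one (ord : Vt → ℕ) (hord : Function.Injective ord) (D : Finset Vt)
    {k : Vt → (∀ v, 𝔛 v) → ℝ} {T : Vt → Finset Vt} (hdep : ∀ d ∈ D, DepOn (k d) (T d))
    (hT : ∀ d ∈ D, ∀ v ∈ T d ∩ D, ord v ≤ ord d)
    (hsum : ∀ d ∈ D, ∀ x, sumOver {d} (k d) x = 1) (x : ∀ v, 𝔛 v) :
    sumOver D (fun y => ∏ d ∈ D, k d y) x = 1 := by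
  induction D using Finset.induction_on_max_value ord generalizing x with
  | empty => simp [sumOver_empty]
  | insert m D hm hmax ih =>
    have hdis : Disjoint D {m} := by simpa using hm
    rw [Finset.insert_eq, Finset.union_comm, ← sumOver_sumOver hdis]
    have key : sumOver {m} (fun y => ∏ d ∈ D ∪ {m}, k d y) = fun y => ∏ d ∈ D, k d y := by
      funext y
      rw [Finset.union_comm, ← Finset.insert_eq]
      simp_rw [Finset.prod_insert hm]
      rw [sumOver_mul_right (T := (D.biUnion T).erase m) (DepOn.prod fun d hd => ?_) (by simp),
        hsum m (by simp), one_mul]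
      refine (hdep d (by simp [hd])).mono fun v hv => ?_
      refine Finset.mem_erase.2 ⟨?_, Finset.mem_biUnion.2 ⟨d, hd, hv⟩⟩
      rintro rfl
      have h1 := hT d (by simp [hd]) v (by simp [hv])
      have h2 := hord (le_antisymm h1 (hmax d hd))
      exact hm (h2 ▸ hd)
    rw [key]
    refine ih (fun d hd => hdep d (by simp [hd])) (fun d hd v hv => hT d (by simp [hd]) v ?_)
      (fun d hd => hsum d (by simp [hd])) x
    simp only [Finset.mem_inter, Finset.mem_insert] at hv ⊢
    exact ⟨hv.1, Or.inr hv.2⟩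

/-- A kernel whose margin over an ancestral set factorizes across `C` satisfies the
corresponding conditional independence. -/
theorem kIndepA_of_factorization {V W N P Q A B C : Finset Vt} {q g h : (∀ v, 𝔛 v) → ℝ}
    (hN : N ⊆ V ∪ W) (hNeq : P ∪ Q ∪ C = N) (hPV : P ⊆ V) (hVW : Disjoint V W)
    (hPQ : Disjoint P Q) (hPC : Disjoint P C) (hQC : Disjoint Q C)
    (hA : A ⊆ P) (hB : B ⊆ Q) (hg : DepOn g (P ∪ C)) (hh : DepOn h (Q ∪ C))
    (hq : ∀ x, sumOver (V \ N) q x = g x * h x) :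
    KIndepA V W q A B C := by
  have hmargin : ∀ R ⊆ P, ∀ x, sumOver (V \ ((P \ R) ∪ B ∪ C)) q x =
      sumOver R g x * sumOver ((V ∩ Q) \ B) h x := by
    intro R hR x
    have hset : V \ ((P \ R) ∪ B ∪ C) = ((V ∩ Q) \ B ∪ R) ∪ (V \ N) := by
      subst hNeq
      ext v
      have : v ∈ P → v ∉ Q := fun h => Finset.disjoint_left.1 hPQ h
      have : v ∈ P → v ∉ C := fun h => Finset.disjoint_left.1 hPC h
      have : v ∈ Q → v ∉ C := fun h => Finset.disjoint_left.1 hQC h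
      grind
    have hd1 : Disjoint ((V ∩ Q) \ B ∪ R) (V \ N) := by
      rw [Finset.disjoint_left]
      intro v hv hv'
      have := @hR v
      subst hNeq
      grind
    have hd2 : Disjoint ((V ∩ Q) \ B) R := by
      rw [Finset.disjoint_left]
      intro v hv hv'
      simp only [Finset.mem_sdiff, Finset.mem_inter] at hv
      exact Finset.disjoint_left.1 hPQ (hR hv') hv.1.2
    rw [hset, ← sumOver_sumOver hd1, ← sumOver_sumOver hd2, funext hq]
    have hRd : Disjoint R (Q ∪ C) := by
      rw [Finset.disjoint_union_right]
      exact ⟨hPQ.mono_left hR, hPC.mono_left hR⟩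
    rw [funext (sumOver_mul_right hh hRd g)]
    refine sumOver_mul_left hg.sumOver ?_ _ _
    rw [Finset.disjoint_left]
    intro v hv hv'
    simp only [Finset.mem_sdiff, Finset.mem_union, Finset.mem_inter] at hv hv'
    rcases hv'.1 with h' | h'
    · exact Finset.disjoint_left.1 hPQ h' hv.1.2
    · exact Finset.disjoint_left.1 hQC hv.1.2 h'
  have hden : ∀ x, sumOver (V \ (B ∪ C)) q x =
      sumOver P g x * sumOver ((V ∩ Q) \ B) h x := by
    simpa using hmargin P subset_rfl
  have hnum : ∀ x, sumOver (V \ (A ∪ B ∪ C)) q x =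
      sumOver (P \ A) g x * sumOver ((V ∩ Q) \ B) h x := by
    have := hmargin (P \ A) Finset.sdiff_subset
    rwa [Finset.sdiff_sdiff_eq_self hA] at this
  refine ⟨?_, fun x y hxy hx hy => ?_⟩
  · exact Finset.disjoint_iff_inter_eq_empty.1 (hVW.mono_left (hA.trans hPV))
  · rw [hden] at hx hy
    rw [hnum, hnum, hden, hden, mul_div_mul_right _ _ (right_ne_zero_of_mul hx.ne'),
      mul_div_mul_right _ _ (right_ne_zero_of_mul hy.ne')]
    have h1 : sumOver P g x = sumOver P g y := hg.sumOver x y fun v hv => hxy v <| by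
      simp only [Finset.mem_sdiff, Finset.mem_union] at hv ⊢
      tauto
    have h2 : sumOver (P \ A) g x = sumOver (P \ A) g y := hg.sumOver x y fun v hv => hxy v <| by
      simp only [Finset.mem_sdiff, Finset.mem_union] at hv ⊢
      tauto
    rw [h1, h2]

/-- A conditional independence of `{m}` from `B` given everything else, stated without
division. -/
theorem mul_sumOver_eq_of_kIndep {V W B C : Finset Vt} {m : Vt} {p : (∀ v, 𝔛 v) → ℝ}
    (hp : ∀ x, 0 ≤ p x) (hdep : DepOn p (V ∪ W)) (hm : m ∈ V)
    (hU : insert m (B ∪ C) = V ∪ W) (hmB : m ∉ B) (hmC : m ∉ C) (hBC : Disjoint B C)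
    (hind : KIndep V W p {m} B C) {x y : ∀ v, 𝔛 v} (hxy : ∀ v ∈ insert m C, x v = y v) :
    p x * sumOver {m} p y = p y * sumOver {m} p x := by
  have hU' : ∀ v, (v = m ∨ v ∈ B ∨ v ∈ C) ↔ (v ∈ V ∨ v ∈ W) := by
    intro v
    simpa using (Finset.ext_iff.1 hU v)
  have hall : V \ ({m} ∪ B ∪ C) = ∅ := by
    ext v
    have := hU' v
    simp only [Finset.mem_sdiff, Finset.mem_union, Finset.mem_singleton, Finset.notMem_empty]
    tauto
  have hall' : V \ (B ∪ {m} ∪ C) = ∅ := by rwa [Finset.union_comm B]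
  have hone : V \ (B ∪ C) = {m} := by
    ext v
    have := hU' v
    simp only [Finset.mem_sdiff, Finset.mem_union, Finset.mem_singleton]
    constructor
    · tauto
    · rintro rfl
      tauto
  rcases hind with ⟨-, h⟩ | ⟨hBW, h⟩
  · rw [hall, hone, sumOver_empty] at h
    rcases (sumOver_nonneg (S := {m}) hp x).eq_or_lt with hx | hx
    · rw [eq_zero_of_sumOver_eq_zero hp hx.symm, ← hx]
      simp
    rcases (sumOver_nonneg (S := {m}) hp y).eq_or_lt with hy | hy
    · rw [eq_zero_of_sumOver_eq_zero hp hy.symm, ← hy]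
      simp
    have := h x y (fun v hv => hxy v (by simpa using hv)) hx hy
    field_simp at this
    linarith
  · have hB : V \ ({m} ∪ C) = B := by
      ext v
      have := hU' v
      have h1 : v ∈ B → v ∉ W := fun hb hw => by
        have : v ∈ B ∩ W := Finset.mem_inter.2 ⟨hb, hw⟩
        simp [hBW] at this
      have h2 : v ∈ B → v ∉ C := fun h => Finset.disjoint_left.1 hBC h
      have h3 : v ∈ B → v ≠ m := fun hb h => hmB (h ▸ hb)
      simp only [Finset.mem_sdiff, Finset.mem_union, Finset.mem_singleton]
      tauto
    rw [hall', hB, sumOver_empty] at h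
    have hmB' : Disjoint {m} B := by simpa using hmB
    have hcross : ∀ z : ∀ v, 𝔛 v, p z * sumOver {m} (sumOver B p) z =
        sumOver {m} p z * sumOver B p z := by
      intro z
      rw [← sumOver_const_mul, mul_comm (sumOver _ _ _), ← sumOver_const_mul]
      refine sumOver_congr fun z' hz' => ?_
      rcases (sumOver_nonneg (S := B) hp z).eq_or_lt with hz | hz
      · rw [eq_zero_of_sumOver_eq_zero hp hz.symm, ← hz]
        simp
      rcases (sumOver_nonneg (S := B) hp z').eq_or_lt with hzz | hzz
      · rw [eq_zero_of_sumOver_eq_zero hp hzz.symm, ← hzz]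
        simp
      have := h z z' (fun v hv => (hz' v ?_).symm) hz hzz
      · field_simp at this
        linarith
      · rintro hvm
        rw [Finset.mem_singleton] at hvm
        subst hvm
        simp [hmB, hmC] at hv
    have hQ : DepOn (sumOver B p) (insert m C) := by
      refine hdep.sumOver.mono fun v hv => ?_
      rw [← hU] at hv
      simp only [Finset.mem_sdiff, Finset.mem_insert, Finset.mem_union] at hv ⊢
      tauto
    have h1 := hQ x y hxy
    have h2 : sumOver {m} (sumOver B p) x = sumOver {m} (sumOver B p) y :=
      hQ.sumOver x y fun v hv => hxy v (Finset.mem_sdiff.1 hv).1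
    have hx := hcross x
    have hy := hcross y
    rw [h1, h2] at hx
    rcases eq_or_ne (sumOver {m} (sumOver B p) y) 0 with h0 | h0
    · have hBnn := sumOver_nonneg (S := B) hp
      rw [eq_zero_of_sumOver_eq_zero hp (eq_zero_of_sumOver_eq_zero hBnn h0),
        eq_zero_of_sumOver_eq_zero hp (eq_zero_of_sumOver_eq_zero hBnn (h2.trans h0))]
      simp
    · refine mul_right_cancel₀ h0 ?_
      linear_combination sumOver {m} p y * hx - sumOver {m} p x * hy

end SumOver


section Walks

variable {Vt : Type} {M : MixedGraph Vt}

theorem isWalk_append {a b : Vt} {p q : List (Step Vt)} :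
    IsWalk M a (p ++ q) b ↔ ∃ c, IsWalk M a p c ∧ IsWalk M c q b := by
  induction p generalizing a with
  | nil => simp [IsWalk]
  | cons s p ih => simp [IsWalk, ih, and_assoc]

theorem isWalk_singleton {a b : Vt} {s : Step Vt} :
    IsWalk M a [s] b ↔ s.src = a ∧ StepIn M s ∧ s.tgt = b := by
  simp [IsWalk]

theorem wverts_cons (a : Vt) (s : Step Vt) (p : List (Step Vt)) :
    wverts a (s :: p) = a :: wverts s.tgt p := rfl

theorem IsWalk.split_of_mem {a b v : Vt} {p : List (Step Vt)} (hp : IsWalk M a p b)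
    (hv : v ∈ wverts a p) : ∃ p₁ p₂, p = p₁ ++ p₂ ∧ IsWalk M a p₁ v ∧ IsWalk M v p₂ b := by
  induction p generalizing a with
  | nil =>
    obtain rfl : v = a := by simpa [wverts] using hv
    exact ⟨[], [], rfl, rfl, hp⟩
  | cons s p ih =>
    rw [wverts_cons, List.mem_cons] at hv
    rcases hv with rfl | hv
    · exact ⟨[], s :: p, rfl, rfl, hp⟩
    · obtain ⟨p₁, p₂, rfl, h₁, h₂⟩ := ih hp.2.2 hv
      exact ⟨s :: p₁, p₂, rfl, ⟨hp.1, hp.2.1, h₁⟩, h₂⟩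

theorem IsWalk.exists_loop {a b : Vt} {p : List (Step Vt)} (hp : IsWalk M a p b)
    (h : ¬ (wverts a p).Nodup) : ∃ v p₁ p₂ p₃, p = p₁ ++ (p₂ ++ p₃) ∧ p₂ ≠ [] ∧
      IsWalk M a p₁ v ∧ IsWalk M v p₂ v ∧ IsWalk M v p₃ b := by
  induction p generalizing a with
  | nil => simp [wverts] at h
  | cons s p ih =>
    by_cases ha : a ∈ wverts s.tgt p
    · obtain ⟨p₁, p₂, rfl, h₁, h₂⟩ := hp.2.2.split_of_mem ha
      exact ⟨a, [], s :: p₁, p₂, rfl, by simp, rfl, ⟨hp.1, hp.2.1, h₁⟩, h₂⟩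
    · rw [wverts_cons, List.nodup_cons, not_and] at h
      obtain ⟨v, p₁, p₂, p₃, rfl, hne, h₁, h₂, h₃⟩ := ih hp.2.2 (h ha)
      exact ⟨v, s :: p₁, p₂, p₃, rfl, hne, ⟨hp.1, hp.2.1, h₁⟩, h₂, h₃⟩

/-- If the condition `J` on consecutive steps survives the removal of loops, then a walk
satisfying it can be shortened to a path satisfying it. -/
theorem IsWalk.exists_path {J : Step Vt → Step Vt → Prop}
    (hJ : ∀ s t p, p ≠ [] → IsWalk M s.tgt p s.tgt → (s :: (p ++ [t])).IsChain J → J s t)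
    {a b : Vt} {p : List (Step Vt)} (hp : IsWalk M a p b) (hc : p.IsChain J) :
    ∃ p', IsWalk M a p' b ∧ (wverts a p').Nodup ∧ p'.IsChain J := by
  induction hn : p.length using Nat.strong_induction_on generalizing p with
  | _ n ih =>
    by_cases hnd : (wverts a p).Nodup
    · exact ⟨p, hp, hnd, hc⟩
    obtain ⟨v, p₁, p₂, p₃, rfl, hne, h₁, h₂, h₃⟩ := hp.exists_loop hnd
    have hlen : 0 < p₂.length := List.length_pos_iff.2 hne
    refine ih (p₁ ++ p₃).length ?_ (isWalk_append.2 ⟨v, h₁, h₃⟩) ?_ rfl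
    · simp only [List.length_append] at hn ⊢
      omega
    · rw [List.isChain_append]
      refine ⟨hc.left_of_append, hc.right_of_append.right_of_append, fun s hs t ht => ?_⟩
      obtain ⟨l, rfl⟩ := List.getLast?_eq_some_iff.1 hs
      obtain ⟨r, rfl⟩ := List.head?_eq_some_iff.1 ht
      obtain ⟨c, -, hsv⟩ := isWalk_append.1 h₁
      obtain ⟨-, -, rfl⟩ := isWalk_singleton.1 hsv
      refine hJ s t p₂ hne h₂ (List.IsChain.left_of_append (l₂ := r)
        (List.IsChain.right_of_append (l₁ := l) ?_))
      simpa using hc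

theorem collider_of_loop {s t : Step Vt} {p : List (Step Vt)} (hne : p ≠ [])
    (hc : (s :: (p ++ [t])).IsChain Collider) : Collider s t := by
  obtain ⟨u, p, rfl⟩ := List.exists_cons_of_ne_nil hne
  have h₁ := (List.isChain_cons_cons.1 hc).1
  have h₂ := (List.isChain_append.1 hc.tail).2.2
  obtain ⟨l, w, hl⟩ := (List.eq_nil_or_concat (u :: p)).resolve_left hne
  have := h₂ w (by simp [hl]) t (by simp)
  exact ⟨h₁.1, this.2⟩

/-- A walk leaving `v` along `v → ⋯` whose colliders are ancestors of `C` either is directed,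
or makes `v` an ancestor of `C`. -/
theorem ancOf_or_htgt_of_jointOK {C : Finset Vt} {v b : Vt} {s : Step Vt} {p : List (Step Vt)}
    (hp : IsWalk M v (s :: p) b) (hs : s.hsrc = false) (hc : (s :: p).IsChain (jointOK M C)) :
    ancOf M C v ∨ ∀ w, (s :: p).getLast? = some w → w.htgt = true := by
  induction p generalizing v s with
  | nil =>
    obtain ⟨-, hstep, -⟩ := hp
    refine Or.inr fun w hw => ?_
    obtain rfl : s = w := by simpa using hw
    rcases hstep with h | h | h <;> simp_all
  | cons t p ih =>
    obtain ⟨rfl, hstep, hp⟩ := hp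
    have hdir : M.dir s.src s.tgt := by
      rcases hstep with h | h | h
      · exact h.2.2
      · simp [hs] at h
      · simp [hs] at h
    rw [List.isChain_cons_cons] at hc
    have hanc : ancOf M C s.tgt → ancOf M C s.src := fun ⟨c, hc, h⟩ => ⟨c, hc, h.head hdir⟩
    rcases hc.1 with ⟨-, h⟩ | ⟨h, -⟩
    · exact Or.inl (hanc h)
    · have ht : t.hsrc = false := by
        have : s.htgt = true := by rcases hstep with h | h | h <;> simp_all
        simpa [Collider, this] using h
      rcases ih hp ht hc.2 with h | h
      · exact Or.inl (hanc h)
      · exact Or.inr fun w hw => h w (by simpa using hw)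

theorem jointOK_of_loop {C : Finset Vt} {s t : Step Vt} {p : List (Step Vt)} (hne : p ≠ [])
    (hp : IsWalk M s.tgt p s.tgt) (hc : (s :: (p ++ [t])).IsChain (jointOK M C)) :
    jointOK M C s t := by
  obtain ⟨u, p, rfl⟩ := List.exists_cons_of_ne_nil hne
  have h₁ := (List.isChain_cons_cons.1 hc).1
  have hmid := List.isChain_append.1 hc.tail
  obtain ⟨l, w, hl⟩ := (List.eq_nil_or_concat (u :: p)).resolve_left hne
  have h₂ := hmid.2.2 w (by simp [hl]) t (by simp)
  have hw : w.tgt = s.tgt := by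
    rw [hl, List.concat_eq_append] at hp
    obtain ⟨c, -, h⟩ := isWalk_append.1 hp
    exact (isWalk_singleton.1 h).2.2
  have h₃ : u.hsrc = false → ancOf M C s.tgt ∨ w.htgt = true := fun hu =>
    (ancOf_or_htgt_of_jointOK hp hu hmid.1).imp_right fun h => h w (by simp [hl])
  simp only [jointOK, Collider, hw] at h₁ h₂ ⊢
  cases hs : s.htgt <;> cases ht : t.hsrc <;> cases hu : u.hsrc <;> cases hwt : w.htgt <;>
    simp_all

/-- `Reach M C a v h`: there is a walk from `a` to `v` that is m-connecting given `C`, where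
`h` tells whether it ends with an arrowhead at `v`. -/
inductive Reach (M : MixedGraph Vt) (C : Finset Vt) (a : Vt) : Vt → Bool → Prop
  | refl : Reach M C a a false
  | step {h : Bool} {s : Step Vt} : Reach M C a s.src h → StepIn M s →
      ((h = true ∧ s.hsrc = true) ∧ ancOf M C s.src ∨
        ¬ (h = true ∧ s.hsrc = true) ∧ s.src ∉ C) → Reach M C a s.tgt s.htgt

theorem Reach.exists_walk {C : Finset Vt} {a v : Vt} {h : Bool} (hr : Reach M C a v h) :
    ∃ p, IsWalk M a p v ∧ p.IsChain (jointOK M C) ∧ ∀ s ∈ p.getLast?, s.htgt = h := by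
  induction hr with
  | refl => exact ⟨[], rfl, List.isChain_nil, by simp⟩
  | @step h s _ hs hj ih =>
    obtain ⟨p, hp, hc, hl⟩ := ih
    refine ⟨p ++ [s], isWalk_append.2 ⟨_, hp, isWalk_singleton.2 ⟨rfl, hs, rfl⟩⟩, ?_, by simp⟩
    rw [List.isChain_append]
    refine ⟨hc, by simp, fun u hu t ht => ?_⟩
    obtain rfl : s = t := by simpa using ht
    obtain ⟨l, rfl⟩ := List.getLast?_eq_some_iff.1 hu
    obtain ⟨c, -, huv⟩ := isWalk_append.1 hp
    have htgt := (isWalk_singleton.1 huv).2.2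
    have := hl u hu
    simpa only [jointOK, Collider, htgt, this] using hj

theorem Reach.mConn {C : Finset Vt} {a v : Vt} {h : Bool} (hr : Reach M C a v h) :
    MConn M C a v := by
  obtain ⟨p, hp, hc, -⟩ := hr.exists_walk
  exact hp.exists_path (fun s t p hne hp hc => jointOK_of_loop hne hp hc) hc

theorem Reach.of_walk {C : Finset Vt} {a u v : Vt} {h : Bool} {p : List (Step Vt)}
    (hr : Reach M C a u h) (hp : IsWalk M u p v) (hc : p.IsChain (jointOK M C))
    (hj : ∀ s ∈ p.head?, (h = true ∧ s.hsrc = true) ∧ ancOf M C u ∨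
      ¬ (h = true ∧ s.hsrc = true) ∧ u ∉ C) : ∃ h', Reach M C a v h' := by
  induction p generalizing u h with
  | nil => exact ⟨h, by cases hp; exact hr⟩
  | cons s p ih =>
    obtain ⟨rfl, hs, hp⟩ := hp
    rw [List.isChain_cons] at hc
    exact ih (hr.step hs (hj s (by simp))) hp hc.2 hc.1

theorem MConn.exists_reach {C : Finset Vt} {a b : Vt} (ha : a ∉ C) (h : MConn M C a b) :
    ∃ h', Reach M C a b h' := by
  obtain ⟨p, hp, -, hc⟩ := h
  exact Reach.refl.of_walk hp hc fun s _ => Or.inr ⟨by simp, ha⟩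

theorem Reach.trans_directed {C : Finset Vt} {a v b : Vt} {h : Bool} (hr : Reach M C a v h)
    (hd : Relation.ReflTransGen M.dir v b) (hv : ¬ ancOf M C v) : ∃ h', Reach M C a b h' := by
  induction hd with
  | refl => exact ⟨h, hr⟩
  | @tail c d hvc hcd ih =>
    obtain ⟨h', hr'⟩ := ih
    exact ⟨true, Reach.step (s := ⟨c, d, false, true⟩) hr' (Or.inl ⟨rfl, rfl, hcd⟩)
      (Or.inr ⟨by simp, fun hc => hv ⟨c, hc, hvc⟩⟩)⟩

theorem Reach.of_directed {C : Finset Vt} {a v : Vt} (hd : Relation.ReflTransGen M.dir v a)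
    (hv : ¬ ancOf M C v) : Reach M C a v false := by
  induction hd using Relation.ReflTransGen.head_induction_on with
  | refl => exact Reach.refl
  | @head v u hvu _ ih =>
    have hu : ¬ ancOf M C u := fun ⟨c, hc, h⟩ => hv ⟨c, hc, h.head hvu⟩
    exact Reach.step (s := ⟨u, v, true, false⟩) (ih hu) (Or.inr (Or.inl ⟨rfl, rfl, hvu⟩))
      (Or.inr ⟨by simp, fun hc => hu ⟨u, hc, .refl⟩⟩)

/-- Extending an m-connecting walk across a vertex that is an ancestor of `A ∪ B ∪ C`: unless
some vertex of `A` is already m-connected to one of `B`, the walk can be rerouted. -/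
theorem Reach.exists_step {A B C : Finset Vt} (hsep : MSep M A B C) {h : Bool} {s : Step Vt}
    (hr : ∃ a ∈ A, Reach M C a s.src h) (hs : StepIn M s)
    (hanc : ancOf M A s.src ∨ ancOf M B s.src ∨ ancOf M C s.src)
    (hC : ¬ (h = true ∧ s.hsrc = true) → s.src ∉ C) : ∃ a ∈ A, Reach M C a s.tgt s.htgt := by
  obtain ⟨a, ha, hr⟩ := hr
  by_cases hcol : h = true ∧ s.hsrc = true
  · by_cases hCs : ancOf M C s.src
    · exact ⟨a, ha, hr.step hs (Or.inl ⟨hcol, hCs⟩)⟩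
    rcases hanc with ⟨a', ha', hd⟩ | ⟨b, hb, hd⟩ | h
    · exact ⟨a', ha', (Reach.of_directed hd hCs).step hs
        (Or.inr ⟨by simp, fun hc => hCs ⟨_, hc, .refl⟩⟩)⟩
    · obtain ⟨h', hr'⟩ := hr.trans_directed hd hCs
      exact absurd hr'.mConn (hsep a ha b hb)
    · exact absurd h hCs
  · exact ⟨a, ha, hr.step hs (Or.inr ⟨hcol, hC hcol⟩)⟩

theorem Reach.exists_collider_walk {A B C : Finset Vt} (hsep : MSep M A B C) {h : Bool}
    {u v : Vt} {p : List (Step Vt)} (hr : ∃ a ∈ A, Reach M C a u h) (hp : IsWalk M u p v)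
    (hc : p.IsChain Collider)
    (hanc : ∀ s ∈ p, ancOf M A s.src ∨ ancOf M B s.src ∨ ancOf M C s.src)
    (hu : ∀ s ∈ p.head?, ¬ (h = true ∧ s.hsrc = true) → u ∉ C) :
    ∃ h', ∃ a ∈ A, Reach M C a v h' := by
  induction p generalizing u h with
  | nil => cases hp; exact ⟨h, hr⟩
  | cons s p ih =>
    obtain ⟨rfl, hs, hp⟩ := hp
    rw [List.isChain_cons] at hc
    exact ih (Reach.exists_step hsep hr hs (hanc s (by simp)) (hu s (by simp))) hp hc.2
      (fun t ht => hanc t (by simp [ht])) fun t ht hn => absurd (hc.1 t ht) hn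

theorem exists_nodup_chain {α : Type*} {r : α → α → Prop} {S : α → Prop}
    (hr : ∀ u v, r u v → S u) {a b : α} (hb : S b) (h : Relation.ReflTransGen r a b) :
    ∃ l : List α, l.IsChain r ∧ l.head? = some a ∧ l.getLast? = some b ∧ l.Nodup ∧
      ∀ v ∈ l, S v := by
  induction h using Relation.ReflTransGen.head_induction_on with
  | refl => exact ⟨[b], by simp, by simp, by simp, by simp, by simpa using hb⟩
  | @head a c hac _ ih =>
    obtain ⟨l, hl, hhead, hlast, hnd, hS⟩ := ih
    by_cases ha : a ∈ l
    · obtain ⟨l₁, l₂, rfl⟩ := List.append_of_mem ha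
      refine ⟨a :: l₂, hl.right_of_append, rfl, by simpa using hlast, ?_, ?_⟩
      · exact (List.nodup_append.1 hnd).2.1
      · exact fun v hv => hS v (List.mem_append_right _ hv)
    · refine ⟨a :: l, ?_, rfl, ?_, List.nodup_cons.2 ⟨ha, hnd⟩, ?_⟩
      · exact List.isChain_cons.2 ⟨fun y hy => by simp_all, hl⟩
      · cases l with
        | nil => simp at hhead
        | cons x l => simpa using hlast
      · rintro v (_ | ⟨_, hv⟩)
        exacts [hr _ _ hac, hS v hv]

end Walks

section Graphs

variable {Vt : Type} {G : PreCADMG Vt}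

theorem augEdge_of_isWalk {a b : Vt} (hab : a ≠ b) {p : List (Step Vt)}
    (hp : IsWalk (augMG G) a p b) (hc : p.IsChain Collider) : augEdge G a b := by
  obtain ⟨p', hp', hnd, hc'⟩ :=
    hp.exists_path (fun s t q hne _ hq => collider_of_loop hne hq) hc
  refine ⟨hab, p', ?_, hp', hnd, hc'⟩
  rintro rfl
  exact hab hp'

theorem exists_walk_of_bi {a b : Vt} (h : Relation.ReflTransGen G.bi a b) :
    ∃ p, IsWalk (augMG G) a p b ∧ (∀ s ∈ p, s.hsrc = true ∧ s.htgt = true) ∧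
      p.IsChain Collider := by
  induction h with
  | refl => exact ⟨[], rfl, by simp, by simp⟩
  | @tail b c _ hbc ih =>
    obtain ⟨p, hp, hall, hc⟩ := ih
    refine ⟨p ++ [⟨b, c, true, true⟩], isWalk_append.2 ⟨b, hp, isWalk_singleton.2
      ⟨rfl, Or.inr (Or.inr ⟨rfl, rfl, Or.inl hbc⟩), rfl⟩⟩, ?_, ?_⟩
    · intro s hs
      rcases List.mem_append.1 hs with hs | hs
      · exact hall s hs
      · simp_all
    · refine hc.append (by simp) fun s hs t ht => ?_
      have := hall s (List.mem_of_getLast? hs)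
      simp at ht
      subst ht
      exact ⟨this.2, rfl⟩

/-- A district together with its parents is a clique of the augmented graph. -/
theorem augEdge_of_mem_district {d x y : Vt} (hsymm : ∀ a b, G.bi a b → G.bi b a)
    (hxy : x ≠ y)
    (hx : x ∈ dis G d ∨ ∃ e ∈ dis G d, G.dir x e) (hy : y ∈ dis G d ∨ ∃ e ∈ dis G d, G.dir y e) :
    augEdge G x y := by
  have : Std.Symm G.bi := ⟨hsymm⟩
  have hbi : ∀ e ∈ dis G d, ∀ e' ∈ dis G d, Relation.ReflTransGen G.bi e e' := fun e he e' he' =>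
    (Relation.ReflTransGen.stdSymm.symm _ _ (Finset.mem_filter.1 he).2).trans
      (Finset.mem_filter.1 he').2
  have hpre : ∃ e ∈ dis G d, ∃ p, IsWalk (augMG G) x p e ∧ p.IsChain Collider ∧
      ∀ s ∈ p, s.htgt = true := by
    rcases hx with hx | ⟨e, he, hxe⟩
    · exact ⟨x, hx, [], rfl, by simp, by simp⟩
    · exact ⟨e, he, [⟨x, e, false, true⟩],
        isWalk_singleton.2 ⟨rfl, Or.inl ⟨rfl, rfl, hxe⟩, rfl⟩, by simp, by simp⟩
  have hsuf : ∃ e ∈ dis G d, ∃ p, IsWalk (augMG G) e p y ∧ p.IsChain Collider ∧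
      ∀ s ∈ p, s.hsrc = true := by
    rcases hy with hy | ⟨e, he, hye⟩
    · exact ⟨y, hy, [], rfl, by simp, by simp⟩
    · exact ⟨e, he, [⟨e, y, true, false⟩],
        isWalk_singleton.2 ⟨rfl, Or.inr (Or.inl ⟨rfl, rfl, hye⟩), rfl⟩, by simp, by simp⟩
  obtain ⟨e, he, p, hp, hpc, hpt⟩ := hpre
  obtain ⟨e', he', q, hq, hqc, hqt⟩ := hsuf
  obtain ⟨r, hr, hall, hrc⟩ := exists_walk_of_bi (hbi e he e' he')
  refine augEdge_of_isWalk hxy (isWalk_append.2 ⟨e, hp, isWalk_append.2 ⟨e', hr, hq⟩⟩)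
    (hpc.append (hrc.append hqc fun s hs t ht => ?_) fun s hs t ht => ?_)
  · exact ⟨(hall s (List.mem_of_getLast? hs)).2, hqt t (List.mem_of_head? ht)⟩
  · refine ⟨hpt s (List.mem_of_getLast? hs), ?_⟩
    rcases List.mem_append.1 (List.mem_of_head? ht) with ht | ht
    exacts [(hall t ht).1, hqt t ht]

theorem not_dir_of_max {ord : Vt → ℕ} (hWF : G.WF) (htopo : IsTopo G ord) {m x : Vt}
    (hx : ord x ≤ ord m) : ¬ G.dir m x := by
  intro h
  rcases hx.lt_or_eq with hlt | heq
  · exact htopo.2 x m hlt (.single h)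
  · obtain rfl := htopo.1 heq
    exact hWF.2.2.2.2 _ (.single h)

theorem dis_eq_of_mem (hsymm : ∀ a b, G.bi a b → G.bi b a) {v d : Vt} (hd : d ∈ dis G v) :
    dis G d = dis G v := by
  have : Std.Symm G.bi := ⟨hsymm⟩
  have hvd := (Finset.mem_filter.1 hd).2
  ext w
  simp only [dis, Finset.mem_filter]
  exact and_congr_right fun _ =>
    ⟨hvd.trans, (Relation.ReflTransGen.stdSymm.symm _ _ hvd).trans⟩

theorem dis_mono {H H' : PreCADMG Vt} (hV : H.V ⊆ H'.V) (hbi : ∀ a b, H.bi a b → H'.bi a b)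
    (v : Vt) : dis H v ⊆ dis H' v := fun w hw => by
  obtain ⟨h1, h2⟩ := Finset.mem_filter.1 hw
  exact Finset.mem_filter.2 ⟨hV h1, Relation.ReflTransGen.mono hbi _ _ h2⟩

variable [DecidableEq Vt]

theorem stepIn_augMG_induce {N : Finset Vt} {s : Step Vt}
    (h : StepIn (augMG (induce G N)) s) : StepIn (augMG G) s ∧ s.src ∈ N := by
  simp only [StepIn, augMG, induce, Finset.mem_inter] at h ⊢
  tauto

theorem isWalk_augMG_induce {N : Finset Vt} {a b : Vt} {p : List (Step Vt)}
    (h : IsWalk (augMG (induce G N)) a p b) : IsWalk (augMG G) a p b ∧ ∀ s ∈ p, s.src ∈ N := by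
  induction p generalizing a with
  | nil => exact ⟨h, by simp⟩
  | cons s p ih =>
    obtain ⟨h₁, h₂⟩ := ih h.2.2
    obtain ⟨h₃, h₄⟩ := stepIn_augMG_induce h.2.1
    refine ⟨⟨h.1, h₃, h₁⟩, ?_⟩
    rintro t (_ | ⟨_, ht⟩)
    exacts [h₄, h₂ t ht]

theorem mem_anS_union {A B C : Finset Vt} {v : Vt} (hv : v ∈ anS G (A ∪ B ∪ C)) :
    ancOf (augMG G) A v ∨ ancOf (augMG G) B v ∨ ancOf (augMG G) C v := by
  obtain ⟨d, hd, h⟩ := (Finset.mem_filter.1 hv).2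
  simp only [Finset.mem_union] at hd
  rcases hd with (hd | hd) | hd
  exacts [.inl ⟨d, hd, h⟩, .inr (.inl ⟨d, hd, h⟩), .inr (.inr ⟨d, hd, h⟩)]

theorem uSep_of_mSep {A B C : Finset Vt}
    (hsep : MSep (augMG G) A B C) :
    USep (augEdge (induce G (anS G (A ∪ B ∪ C)))) C A B := by
  intro a ha b hb l hl hhead hlast _
  by_contra! hC
  have key : ∀ (l : List Vt) (u : Vt) (h : Bool), (∃ a ∈ A, Reach (augMG G) C a u h) →
      l.IsChain (augEdge (induce G (anS G (A ∪ B ∪ C)))) → l.head? = some u →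
      l.getLast? = some b → (∀ v ∈ l, v ∉ C) → ∃ h', ∃ a ∈ A, Reach (augMG G) C a b h' := by
    intro l
    induction l with
    | nil => simp
    | cons x l ih =>
      intro u h hr hl hhead hlast hC
      obtain rfl : x = u := by simpa using hhead
      cases l with
      | nil =>
        obtain rfl : x = b := by simpa using hlast
        exact ⟨h, hr⟩
      | cons y l =>
        rw [List.isChain_cons_cons] at hl
        obtain ⟨-, p, -, hp, -, hpc⟩ := hl.1
        obtain ⟨hp, hpN⟩ := isWalk_augMG_induce hp
        obtain ⟨h', hr'⟩ := Reach.exists_collider_walk hsep hr hp hpc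
          (fun s hs => mem_anS_union (hpN s hs)) fun _ _ _ => hC x (by simp)
        exact ih y h' hr' hl.2 rfl (by simpa using hlast) fun v hv => hC v (by simp_all)
  obtain ⟨h', a', ha', hr⟩ := key l a false ⟨a, ha, Reach.refl⟩ hl hhead hlast hC
  exact hsep a' ha' b hb hr.mConn

end Graphs


section Equivalence

variable {Vt : Type} [DecidableEq Vt] {G : PreCADMG Vt}

theorem dir_mem (hWF : G.WF) {a b : Vt} (h : G.dir a b) : a ∈ G.V ∪ G.W ∧ b ∈ G.V := by
  simpa only [Finset.mem_union] using hWF.2.2.1 a b h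

theorem ancestral_anS (S : Finset Vt) : Ancestral G (anS G S) := by
  refine ⟨Finset.filter_subset _ _, fun a ha b hb hba => ?_⟩
  obtain ⟨d, hd, had⟩ := (Finset.mem_filter.1 ha).2
  exact Finset.mem_filter.2 ⟨hb, d, hd, hba.trans had⟩

theorem subset_anS {S T : Finset Vt} (hT : T ⊆ G.V ∪ G.W) (hTS : T ⊆ S) : T ⊆ anS G S :=
  fun v hv => Finset.mem_filter.2 ⟨hT hv, v, hTS hv, .refl⟩

theorem Ancestral.mem_of_dir {N : Finset Vt} (hWF : G.WF) (hN : Ancestral G N) {a b : Vt}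
    (h : G.dir a b) (hb : b ∈ N) : a ∈ N :=
  hN.2 b hb a (dir_mem hWF h).1 (.single h)

theorem district_scope {N D : Finset Vt} (hWF : G.WF) (hN : Ancestral G N)
    (hD : D ∈ districts (induce G N)) {x : Vt} (hx : x ∈ D ∪ (paS G D \ D)) :
    x ∈ N ∧ (x ∈ D ∨ ∃ e ∈ D, (induce G N).dir x e) := by
  obtain ⟨d, -, rfl⟩ := Finset.mem_image.1 hD
  have hsub : ∀ v ∈ dis (induce G N) d, v ∈ N := fun v hv =>
    (Finset.mem_inter.1 (Finset.mem_filter.1 hv).1).2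
  rcases Finset.mem_union.1 hx with hx | hx
  · exact ⟨hsub x hx, Or.inl hx⟩
  · obtain ⟨e, he, hxe⟩ := (Finset.mem_filter.1 (Finset.mem_sdiff.1 hx).1).2
    have hxN := hN.mem_of_dir hWF hxe (hsub e he)
    exact ⟨hxN, Or.inr ⟨e, he, hxe, hxN, hsub e he⟩⟩

theorem induce_bi_symm {N : Finset Vt} (hWF : G.WF) :
    ∀ a b, (induce G N).bi a b → (induce G N).bi b a :=
  fun _ _ h => ⟨hWF.2.1 _ _ h.1, h.2.2, h.2.1⟩

variable {𝔛 : Vt → Type} [∀ v, Fintype (𝔛 v)] {q : (∀ v, 𝔛 v) → ℝ}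

theorem pca_of_pcf (hWF : G.WF) (h : Pcf G q) : Pca G q := by
  intro A B C hA hB hC hAB hAC hBC hsep
  set N := anS G (A ∪ B ∪ C) with hNdef
  have hN : Ancestral G N := ancestral_anS _
  have hAN : A ⊆ N := subset_anS hA fun v hv => by simp [hv]
  have hBN : B ⊆ N := subset_anS hB fun v hv => by simp [hv]
  have hCN : C ⊆ N := subset_anS hC fun v hv => by simp [hv]
  obtain ⟨f, hf, hfq⟩ := h N hN
  set E := augEdge (induce G N) with hE
  let r : Vt → Vt → Prop := fun u v => E u v ∧ u ∉ C ∧ v ∉ C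
  let P := N.filter fun v => v ∉ C ∧ ∃ a ∈ A, Relation.ReflTransGen r a v
  let Q := N.filter fun v => v ∉ C ∧ ¬ ∃ a ∈ A, Relation.ReflTransGen r a v
  have hP : ∀ v, v ∈ P ↔ v ∈ N ∧ v ∉ C ∧ ∃ a ∈ A, Relation.ReflTransGen r a v :=
    fun v => Finset.mem_filter
  have hQ : ∀ v, v ∈ Q ↔ v ∈ N ∧ v ∉ C ∧ ¬ ∃ a ∈ A, Relation.ReflTransGen r a v :=
    fun v => Finset.mem_filter
  have hclosed : ∀ u ∈ P, ∀ v ∈ N, v ∉ C → (u ≠ v → E u v) → v ∈ P := by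
    intro u hu v hv hvC huv
    rcases eq_or_ne u v with rfl | hne
    · exact hu
    obtain ⟨-, huC, a, ha, hau⟩ := (hP u).1 hu
    exact (hP v).2 ⟨hv, hvC, a, ha, hau.tail ⟨huv hne, huC, hvC⟩⟩
  have hAP : A ⊆ P := fun v hv =>
    (hP v).2 ⟨hAN hv, Finset.disjoint_left.1 hAC hv, v, hv, .refl⟩
  have hBQ : B ⊆ Q := by
    intro b hb
    have hbC := Finset.disjoint_left.1 hBC hb
    refine (hQ b).2 ⟨hBN hb, hbC, ?_⟩
    rintro ⟨a, ha, hab⟩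
    obtain ⟨l, hl, hhead, hlast, hnd, hS⟩ :=
      exists_nodup_chain (S := (· ∉ C)) (fun u v h => h.2.1) hbC hab
    obtain ⟨v, hv, hvC⟩ := hsep a ha b hb l (hl.imp fun _ _ h => h.1) hhead hlast hnd
    exact hS v hv hvC
  have hPQ : Disjoint P Q :=
    Finset.disjoint_left.2 fun v hv hv' => ((hQ v).1 hv').2.2 ((hP v).1 hv).2.2
  have hPC : Disjoint P C := Finset.disjoint_left.2 fun v hv => ((hP v).1 hv).2.1
  have hQC : Disjoint Q C := Finset.disjoint_left.2 fun v hv => ((hQ v).1 hv).2.1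
  have hunion : P ∪ Q ∪ C = N := by
    ext v
    have := @hCN v
    simp only [Finset.mem_union, hP, hQ]
    tauto
  have hclique : ∀ D ∈ districts (induce G N), ∀ x ∈ D ∪ (paS G D \ D),
      ∀ y ∈ D ∪ (paS G D \ D), x ≠ y → E x y := by
    intro D hD x hx y hy hxy
    have hx' := (district_scope hWF hN hD hx).2
    have hy' := (district_scope hWF hN hD hy).2
    obtain ⟨d, -, rfl⟩ := Finset.mem_image.1 hD
    exact augEdge_of_mem_district (induce_bi_symm hWF) hxy hx' hy'
  let meets : Finset Vt → Prop := fun D => ∃ v ∈ D ∪ (paS G D \ D), v ∈ P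
  let g : (∀ v, 𝔛 v) → ℝ := fun x => ∏ D ∈ (districts (induce G N)).filter meets, f D x
  let k : (∀ v, 𝔛 v) → ℝ :=
    fun x => ∏ D ∈ (districts (induce G N)).filter fun D => ¬ meets D, f D x
  have hg : DepOn g (P ∪ C) := by
    refine DepOn.prod fun D hD => ?_
    obtain ⟨hD, u, hu, huP⟩ := Finset.mem_filter.1 hD
    refine (hf D hD).2.1.mono fun v hv => ?_
    rw [Finset.mem_union]
    by_cases hvC : v ∈ C
    · exact Or.inr hvC
    · exact Or.inl (hclosed u huP v (district_scope hWF hN hD hv).1 hvC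
        (hclique D hD u hu v hv))
  have hk : DepOn k (Q ∪ C) := by
    refine DepOn.prod fun D hD => ?_
    obtain ⟨hD, hmeet⟩ := Finset.mem_filter.1 hD
    refine (hf D hD).2.1.mono fun v hv => ?_
    have hvN := (district_scope hWF hN hD hv).1
    rw [← hunion] at hvN
    simp only [Finset.mem_union] at hvN ⊢
    rcases hvN with (h | h) | h
    exacts [absurd ⟨v, hv, h⟩ hmeet, Or.inl h, Or.inr h]
  have hgk : ∀ x, sumOver (G.V \ N) q x = g x * k x := fun x => by
    rw [hfq x]
    exact (Finset.prod_filter_mul_prod_filter_not _ _ _).symm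
  have hPN : P ⊆ N := Finset.filter_subset _ _
  have hQN : Q ⊆ N := Finset.filter_subset _ _
  have hsub : ∀ {S : Finset Vt}, S ⊆ N → (∀ w ∈ S, w ∉ G.W) → S ⊆ G.V := fun hS hW v hv =>
    (Finset.mem_union.1 (hN.1 (hS hv))).resolve_right (hW v hv)
  by_cases hPW : ∃ w ∈ P, w ∈ G.W
  · obtain ⟨w, hwP, hwW⟩ := hPW
    have hQV : Q ⊆ G.V := by
      refine hsub hQN fun w' hw' hw'W => Finset.disjoint_right.1 hPQ hw' ?_
      refine hclosed w hwP w' (hQN hw') ((hQ w').1 hw').2.1 fun hne => ?_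
      exact augEdge_of_isWalk hne (isWalk_singleton (s := ⟨w, w', true, true⟩) |>.2
        ⟨rfl, Or.inr (Or.inr ⟨rfl, rfl, Or.inr ⟨Finset.mem_inter.2 ⟨hwW, hPN hwP⟩,
          Finset.mem_inter.2 ⟨hw'W, hQN hw'⟩, hne⟩⟩), rfl⟩) (by simp)
    exact Or.inr (kIndepA_of_factorization hN.1 (by rw [← hunion, Finset.union_comm Q]) hQV hWF.1
      hPQ.symm hQC hPC hBQ hAP hk hg fun x => by rw [hgk, mul_comm])
  · push Not at hPW
    exact Or.inl (kIndepA_of_factorization hN.1 hunion (hsub hPN hPW) hWF.1 hPQ hPC hQC hAP hBQ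
      hg hk hgk)

theorem pcm_of_pca (h : Pca G q) : Pcm G q :=
  fun A B C hA hB hC hAB hAC hBC hsep => h A B C hA hB hC hAB hAC hBC (uSep_of_mSep hsep)

theorem kIndepA_margin {V W N A B C : Finset Vt} (hN : V ∩ (A ∪ B ∪ C) ⊆ N)
    (h : KIndepA V W q A B C) : KIndepA (V ∩ N) W (sumOver (V \ N) q) A B C := by
  have key : ∀ S ⊆ A ∪ B ∪ C,
      sumOver ((V ∩ N) \ S) (sumOver (V \ N) q) = sumOver (V \ S) q := by
    intro S hS
    rw [sumOver_sumOver]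
    · congr 1
      ext v
      have h1 := @hS v
      have h2 := @hN v
      simp only [Finset.mem_union, Finset.mem_inter, Finset.mem_sdiff] at h1 h2 ⊢
      tauto
    · rw [Finset.disjoint_left]
      intro v hv hv'
      simp only [Finset.mem_inter, Finset.mem_sdiff] at hv hv'
      exact hv'.2 hv.1.2
  refine ⟨h.1, ?_⟩
  rw [key _ subset_rfl, key _ fun v hv => ?_]
  · exact h.2
  · simp only [Finset.mem_union] at hv ⊢
    tauto

theorem induce_V (hWF : G.WF) (A : Finset Vt) :
    (induce G ((G.V ∩ A) ∪ G.W)).V = G.V ∩ A := by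
  ext v
  have : v ∈ G.V → v ∉ G.W := fun h => Finset.disjoint_left.1 hWF.1 h
  simp only [induce, Finset.mem_inter, Finset.mem_union]
  tauto

theorem induce_W (A : Finset Vt) : (induce G ((G.V ∩ A) ∪ G.W)).W = G.W := by
  ext v
  simp only [induce, Finset.mem_inter, Finset.mem_union]
  tauto

theorem mb_subset (t : Vt) : mb G t ⊆ G.V ∪ G.W := by
  refine Finset.union_subset (Finset.filter_subset _ _) fun v hv => ?_
  exact Finset.mem_union_left _ (Finset.mem_filter.1 (Finset.mem_of_mem_erase hv)).1

theorem notMem_mb {t : Vt} (h : ∀ v ∈ G.V, ¬ G.dir t v) : t ∉ mb G t := by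
  simp only [mb, Finset.mem_union, paS, Finset.mem_filter, not_or]
  refine ⟨?_, by simp⟩
  rintro ⟨-, d, hd, htd⟩
  exact h d (Finset.mem_filter.1 hd).1 htd

theorem Ancestral.mem_union_of_dir {A : Finset Vt} (hWF : G.WF) (hA : Ancestral G A) {a b : Vt}
    (h : G.dir a b) (hb : b ∈ (G.V ∩ A) ∪ G.W) : a ∈ (G.V ∩ A) ∪ G.W := by
  obtain ⟨ha, hbV⟩ := dir_mem hWF h
  have hbA : b ∈ A := by
    rcases Finset.mem_union.1 hb with hb | hb
    · exact (Finset.mem_inter.1 hb).2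
    · exact absurd hb (Finset.disjoint_left.1 hWF.1 hbV)
  have haA := hA.mem_of_dir hWF h hbA
  simp only [Finset.mem_union, Finset.mem_inter] at ha ⊢
  tauto

/-- A childless vertex is m-separated from the rest of an ancestral set by its Markov blanket. -/
theorem mSep_mb {A : Finset Vt} (hWF : G.WF) (hA : Ancestral G A) {m : Vt} (hm : m ∈ G.V ∩ A)
    (hch : ∀ x ∈ A, ¬ G.dir m x) :
    MSep (augMG G) {m}
      (((G.V ∩ A) ∪ G.W) \ insert m (mb (induce G ((G.V ∩ A) ∪ G.W)) m))
      (mb (induce G ((G.V ∩ A) ∪ G.W)) m) := by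
  set U := (G.V ∩ A) ∪ G.W with hU
  set H := induce G U with hH
  have hHV : H.V = G.V ∩ A := induce_V hWF A
  have hHW : H.W = G.W := induce_W A
  have hHU : H.V ∪ H.W = U := by rw [hHV, hHW]
  have hmH : ∀ v ∈ H.V, ¬ H.dir m v := fun v hv h =>
    hch v (Finset.mem_inter.1 (hHV ▸ hv)).2 h.1
  have hVU : ∀ x ∈ G.V, x ∉ A → x ∉ U := by
    intro x hx hxA hxU
    rcases Finset.mem_union.1 hxU with h | h
    · exact hxA (Finset.mem_inter.1 h).2
    · exact Finset.disjoint_left.1 hWF.1 hx h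
  have hUdir : ∀ a b, G.dir a b → b ∈ U → a ∈ U := fun a b h hb =>
    hA.mem_union_of_dir hWF h hb
  have hUanc : ∀ a, ancOf (augMG G) (mb H m) a → a ∈ U := by
    rintro a ⟨c, hc, hac⟩
    have hcU : c ∈ U := hHU ▸ mb_subset m hc
    induction hac using Relation.ReflTransGen.head_induction_on with
    | refl => exact hcU
    | head h _ ih => exact hUdir _ _ h ih
  have hinv : ∀ v h, Reach (augMG G) (mb H m) m v h →
      (v ∈ dis H m ∧ (h = true ∨ v = m)) ∨ (v ∈ mb H m ∧ h = false) ∨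
        (v ∉ U ∧ h = true) := by
    intro v h hr
    induction hr with
    | refl => exact Or.inl ⟨Finset.mem_filter.2 ⟨hHV ▸ hm, .refl⟩, Or.inr rfl⟩
    | @step h s _ hs hj ih =>
      rcases ih with ⟨hdis, hh⟩ | ⟨hmb, rfl⟩ | ⟨hnU, rfl⟩
      · have hsV : s.src ∈ G.V ∩ A := hHV ▸ (Finset.mem_filter.1 hdis).1
        have hsU : s.src ∈ U := Finset.mem_union_left _ hsV
        rcases hs with ⟨hsrc, htgt, hdir⟩ | ⟨hsrc, htgt, hdir⟩ | ⟨hsrc, htgt, hbi⟩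
        · have hsm : s.src = m := by
            by_contra hne
            rcases hj with hj | hj
            · simp [hsrc] at hj
            · exact hj.2 (Finset.mem_union_right _ (Finset.mem_erase.2 ⟨hne, hdis⟩))
          refine Or.inr (Or.inr ⟨hVU _ (dir_mem hWF hdir).2 fun hA' => ?_, htgt⟩)
          exact hch _ hA' (hsm ▸ hdir)
        · have hU' := hUdir _ _ hdir hsU
          refine Or.inr (Or.inl ⟨Finset.mem_union_left _ (Finset.mem_filter.2 ⟨hHU ▸ hU', ?_⟩),
            htgt⟩)
          exact ⟨s.src, hdis, hdir, hU', hsU⟩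
        · rcases hbi with hbi | ⟨hW, -⟩
          · have htV := (hWF.2.2.2.1 _ _ hbi).2
            by_cases htA : s.tgt ∈ A
            · have htVA : s.tgt ∈ G.V ∩ A := Finset.mem_inter.2 ⟨htV, htA⟩
              refine Or.inl ⟨Finset.mem_filter.2 ⟨hHV ▸ htVA, ?_⟩, Or.inl htgt⟩
              exact (Finset.mem_filter.1 hdis).2.tail ⟨hbi, hsU, Finset.mem_union_left _ htVA⟩
            · exact Or.inr (Or.inr ⟨hVU _ htV htA, htgt⟩)
          · exact absurd hW (Finset.disjoint_left.1 hWF.1 (Finset.mem_inter.1 hsV).1)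
      · rcases hj with hj | hj
        · simp at hj
        · exact absurd hmb hj.2
      · have hsrc : s.hsrc = false := by
          rcases hj with hj | hj
          · exact absurd (hUanc _ hj.2) hnU
          · simpa using hj.1
        rcases hs with ⟨-, htgt, hdir⟩ | ⟨h, -⟩ | ⟨h, -⟩
        · exact Or.inr (Or.inr ⟨fun hU' => hnU (hUdir _ _ hdir hU'), htgt⟩)
        · simp [hsrc] at h
        · simp [hsrc] at h
  intro a ha b hb hconn
  obtain rfl : a = m := by simpa using ha
  obtain ⟨hbU, hb⟩ := Finset.mem_sdiff.1 hb
  rw [Finset.mem_insert, not_or] at hb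
  obtain ⟨h, hr⟩ := hconn.exists_reach (notMem_mb hmH)
  rcases hinv b h hr with ⟨hd, -⟩ | ⟨hmb, -⟩ | ⟨hn, -⟩
  · exact hb.2 (Finset.mem_union_right _ (Finset.mem_erase.2 ⟨hb.1, hd⟩))
  · exact hb.2 hmb
  · exact hn hbU

theorem pcl_of_pcm {ord : Vt → ℕ} (hWF : G.WF) (htopo : IsTopo G ord) (h : Pcm G q) :
    Pcl G ord q := by
  intro A hA m hmA hmax hmV
  have hm : m ∈ G.V ∩ A := Finset.mem_inter.2 ⟨hmV, hmA⟩
  have hch : ∀ x ∈ A, ¬ G.dir m x := fun x hx => not_dir_of_max hWF htopo (hmax x hx)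
  have hsep := mSep_mb hWF hA hm hch
  unfold LocalAt
  have hmbU := mb_subset (G := induce G ((G.V ∩ A) ∪ G.W)) m
  have hmmb : m ∉ mb (induce G ((G.V ∩ A) ∪ G.W)) m := notMem_mb fun v hv h =>
    hch v (Finset.mem_inter.1 (induce_V hWF A ▸ hv)).2 h.1
  rw [induce_V hWF, induce_W] at hmbU ⊢
  set C := mb (induce G ((G.V ∩ A) ∪ G.W)) m
  have hUsub : (G.V ∩ A) ∪ G.W ⊆ G.V ∪ G.W :=
    Finset.union_subset_union Finset.inter_subset_left subset_rfl
  have hN : ∀ S ⊆ (G.V ∩ A) ∪ G.W, G.V ∩ S ⊆ A := by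
    intro S hS v hv
    obtain ⟨hvV, hvS⟩ := Finset.mem_inter.1 hv
    rcases Finset.mem_union.1 (hS hvS) with h | h
    · exact (Finset.mem_inter.1 h).2
    · exact absurd h (Finset.disjoint_left.1 hWF.1 hvV)
  have hmU : {m} ⊆ (G.V ∩ A) ∪ G.W := by simpa using Or.inl (Finset.mem_inter.1 hm)
  rcases h {m} _ C (by simp [hmV]) (Finset.sdiff_subset.trans hUsub) (hmbU.trans hUsub)
    (by simp) (by simpa using hmmb)
    (Finset.disjoint_left.2 fun v hv hv' => (Finset.mem_sdiff.1 hv).2 (by simp [hv'])) hsep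
    with h | h
  · exact Or.inl (kIndepA_margin (hN _ (Finset.union_subset (Finset.union_subset hmU
      Finset.sdiff_subset) hmbU)) h)
  · exact Or.inr (kIndepA_margin (hN _ (Finset.union_subset (Finset.union_subset
      Finset.sdiff_subset hmU) hmbU)) h)

/-- A version of the conditional kernel of `m` given `C` defined everywhere. -/
theorem exists_conditional_kernel [Fintype Vt] {p : (∀ v, 𝔛 v) → ℝ} (hp : ∀ x, 0 ≤ p x) {m : Vt}
    {C : Finset Vt} (hmC : m ∉ C)
    (hind : ∀ x y : ∀ v, 𝔛 v, (∀ v ∈ insert m C, x v = y v) →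
      p x * sumOver {m} p y = p y * sumOver {m} p x) :
    ∃ k : (∀ v, 𝔛 v) → ℝ, (∀ x, 0 ≤ k x) ∧ (∀ x, sumOver {m} k x = 1) ∧
      DepOn k (insert m C) ∧ ∀ x, p x = k x * sumOver {m} p x := by
  let S := Finset.univ \ insert m C
  have hmS : Disjoint S {m} := by simp [S]
  have hcompl : Finset.univ \ S = insert m C := by simp [S]
  let num := sumOver S p
  let den := sumOver S (sumOver {m} p)
  have hden : den = sumOver {m} num := sumOver_sumOver_comm hmS p
  have hnumdep : DepOn num (insert m C) := by
    rw [← hcompl]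
    exact DepOn.sumOver fun x y hxy => by rw [funext fun v => hxy v (Finset.mem_univ v)]
  have hdendep : DepOn den C := by
    rw [hden]
    exact hnumdep.sumOver.mono fun v hv => by
      simp only [Finset.mem_sdiff, Finset.mem_insert, Finset.mem_singleton] at hv
      tauto
  let c : ℝ := (Fintype.card ((v : {v : Vt // v ∈ ({m} : Finset Vt)}) → 𝔛 v.1) : ℝ)⁻¹
  refine ⟨fun x => if den x = 0 then c else num x * (den x)⁻¹, fun x => ?_, fun x => ?_,
    fun x y hxy => ?_, fun x => ?_⟩
  · dsimp only
    split_ifs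
    · positivity
    · exact mul_nonneg (sumOver_nonneg hp x)
        (inv_nonneg.2 (sumOver_nonneg (fun y => sumOver_nonneg hp y) x))
  · have hloc : ∀ y : ∀ v, 𝔛 v, (∀ v ∉ ({m} : Finset Vt), y v = x v) → den y = den x :=
      fun y hy => hdendep y x fun v hv => hy v fun h => hmC (Finset.mem_singleton.1 h ▸ hv)
    by_cases h0 : den x = 0
    · rw [sumOver_congr (g := fun _ => c) fun y hy => by simp [hloc y hy, h0]]
      have : Nonempty ((v : {v : Vt // v ∈ ({m} : Finset Vt)}) → 𝔛 v.1) := ⟨fun v => x v.1⟩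
      simp only [sumOver, Finset.sum_const, Finset.card_univ, nsmul_eq_mul, c]
      exact mul_inv_cancel₀ (by exact_mod_cast Fintype.card_ne_zero)
    · rw [sumOver_congr (g := fun y => (den x)⁻¹ * num y)
        fun y hy => by simp [hloc y hy, h0, mul_comm], sumOver_const_mul, ← hden]
      exact inv_mul_cancel₀ h0
  · have h1 := hdendep x y fun v hv => hxy v (Finset.mem_insert_of_mem hv)
    simp only [h1, hnumdep x y hxy]
  · dsimp only
    split_ifs with h0
    · have h1 := eq_zero_of_sumOver_eq_zero (fun y => sumOver_nonneg hp y) h0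
      rw [h1, eq_zero_of_sumOver_eq_zero hp h1, mul_zero]
    · have h1 : p x * den x = sumOver {m} p x * num x := by
        simp only [den, num]
        rw [← sumOver_const_mul, ← sumOver_const_mul]
        refine sumOver_congr fun y hy => ?_
        rw [hind x y fun v hv => (hy v fun hvS => (Finset.mem_sdiff.1 hvS).2 hv).symm, mul_comm]
      field_simp
      linarith

theorem paS_mono {D D' : Finset Vt} (h : D ⊆ D') : paS G D ⊆ paS G D' := fun w hw => by
  obtain ⟨h1, d, hd, h2⟩ := Finset.mem_filter.1 hw
  exact Finset.mem_filter.2 ⟨h1, d, h hd, h2⟩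

/-- Under the ordered local Markov property every ancestral margin is a product of conditional
kernels, each involving only earlier vertices of the district and parents of the district. -/
theorem exists_conditional_factorization [Fintype Vt] {ord : Vt → ℕ} (hWF : G.WF)
    (htopo : IsTopo G ord) (hq : IsKernel G.V G.W q) (hl : Pcl G ord q) (A : Finset Vt)
    (hA : Ancestral G A) :
    ∃ k : Vt → (∀ v, 𝔛 v) → ℝ, (∀ d ∈ G.V ∩ A, (∀ x, 0 ≤ k d x) ∧
      (∀ x, sumOver {d} (k d) x = 1) ∧
      DepOn (k d) ((dis (induce G A) d ∪ paS G (dis (induce G A) d)).filter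
        fun v => v ∈ G.V → ord v ≤ ord d)) ∧
      ∀ x, sumOver (G.V \ A) q x = ∏ d ∈ G.V ∩ A, k d x := by
  induction hn : (G.V ∩ A).card generalizing A with
  | zero =>
    rw [Finset.card_eq_zero] at hn
    refine ⟨fun _ _ => 1, by simp [hn], fun x => ?_⟩
    rw [Finset.sdiff_eq_self_of_disjoint (Finset.disjoint_iff_inter_eq_empty.2 hn), hq.2.2, hn,
      Finset.prod_empty]
  | succ n ih =>
    obtain ⟨m, hm, hmax⟩ := Finset.exists_max_image (G.V ∩ A) ord
      (Finset.card_pos.1 (by omega))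
    obtain ⟨hmV, hmA⟩ := Finset.mem_inter.1 hm
    have hVA : G.V ∩ A.erase m = (G.V ∩ A).erase m := Finset.inter_erase m G.V A
    have hch : ∀ x ∈ A, ¬ G.dir m x := fun x hx h =>
      not_dir_of_max hWF htopo (hmax x (Finset.mem_inter.2 ⟨(dir_mem hWF h).2, hx⟩)) h
    have hA₀ : Ancestral G (A.erase m) := by
      refine ⟨(Finset.erase_subset _ _).trans hA.1, fun a ha b hb hba => ?_⟩
      obtain ⟨ham, haA⟩ := Finset.mem_erase.1 ha
      refine Finset.mem_erase.2 ⟨?_, hA.2 a haA b hb hba⟩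
      rintro rfl
      rcases hba.cases_tail with h | ⟨c, -, hca⟩
      · exact ham h
      · have hle := hmax a (Finset.mem_inter.2 ⟨(dir_mem hWF hca).2, haA⟩)
        exact htopo.2 a b (hle.lt_of_ne fun h => ham (htopo.1 h)) hba
    obtain ⟨k, hk, hkq⟩ := ih (A.erase m) hA₀ (by rw [hVA, Finset.card_erase_of_mem hm]; omega)
    set p := sumOver (G.V \ A) q with hp
    have hsumA₀ : sumOver (G.V \ A.erase m) q = sumOver {m} p := by
      rw [hp, sumOver_sumOver (by simp [hmA])]
      congr 1
      ext v
      by_cases hv : v = m <;> simp [hv, hmV]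
    let A' := A.filter fun a => ord a ≤ ord m
    have hA' : Ancestral G A' := by
      refine ⟨(Finset.filter_subset _ _).trans hA.1, fun a ha b hb hba => ?_⟩
      obtain ⟨haA, ham⟩ := Finset.mem_filter.1 ha
      refine Finset.mem_filter.2 ⟨hA.2 a haA b hb hba, ?_⟩
      by_contra! hlt
      exact htopo.2 a b (ham.trans_lt hlt) hba
    have hVA' : G.V ∩ A' = G.V ∩ A := by
      ext v
      have := hmax v
      simp only [A', Finset.mem_inter, Finset.mem_filter] at this ⊢
      tauto
    have hVsA' : G.V \ A' = G.V \ A := by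
      rw [← Finset.sdiff_inter_self_left, hVA', Finset.sdiff_inter_self_left]
    have hloc := hl A' hA' m (Finset.mem_filter.2 ⟨hmA, le_rfl⟩)
      (fun a ha => (Finset.mem_filter.1 ha).2) hmV
    rw [hVA', hVsA', LocalAt] at hloc
    set H := induce G ((G.V ∩ A) ∪ G.W) with hH
    have hHV : H.V = G.V ∩ A := induce_V hWF A
    have hHW : H.W = G.W := induce_W A
    have hmbU := mb_subset (G := H) m
    have hmmb : m ∉ mb H m := notMem_mb fun v hv h =>
      hch v (Finset.mem_inter.1 (hHV ▸ hv)).2 h.1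
    rw [hHV, hHW] at hloc hmbU
    have hpnn : ∀ x, 0 ≤ p x := sumOver_nonneg hq.1
    have hpdep : DepOn p ((G.V ∩ A) ∪ G.W) := hq.2.1.sumOver.mono fun v hv => by
      simp only [Finset.mem_sdiff, Finset.mem_union, Finset.mem_inter] at hv ⊢
      tauto
    have hall : insert m (((G.V ∩ A) ∪ G.W) \ insert m (mb H m) ∪ mb H m) =
        (G.V ∩ A) ∪ G.W := by
      rw [← Finset.union_insert, Finset.sdiff_union_of_subset]
      exact Finset.insert_subset (Finset.mem_union_left _ hm) hmbU
    obtain ⟨km, hkm₀, hkm₁, hkmdep, hkm⟩ := exists_conditional_kernel hpnn hmmb fun x y hxy =>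
      mul_sumOver_eq_of_kIndep hpnn hpdep hm hall (by simp) hmmb
        (Finset.disjoint_left.2 fun v hv hv' => (Finset.mem_sdiff.1 hv).2 (by simp [hv'])) hloc hxy
    refine ⟨Function.update k m km, fun d hd => ?_, fun x => ?_⟩
    · rcases eq_or_ne d m with rfl | hdm
      · rw [Function.update_self]
        refine ⟨hkm₀, hkm₁, hkmdep.mono fun v hv => Finset.mem_filter.2 ⟨?_, fun hvV => ?_⟩⟩
        · have hdis : dis H d ⊆ dis (induce G A) d := by
            refine dis_mono (hHV ▸ subset_rfl) (fun a b h => ?_) d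
            have hab := hWF.2.2.2.1 _ _ h.1
            have hin : ∀ c ∈ G.V, c ∈ (G.V ∩ A) ∪ G.W → c ∈ A := fun c hc h => by
              rcases Finset.mem_union.1 h with h | h
              · exact (Finset.mem_inter.1 h).2
              · exact absurd h (Finset.disjoint_left.1 hWF.1 hc)
            exact ⟨h.1, hin a hab.1 h.2.1, hin b hab.2 h.2.2⟩
          rcases Finset.mem_insert.1 hv with rfl | hv
          · exact Finset.mem_union_left _ (Finset.mem_filter.2 ⟨hd, .refl⟩)
          rcases Finset.mem_union.1 hv with hv | hv
          · obtain ⟨-, e, he, hve⟩ := Finset.mem_filter.1 hv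
            exact Finset.mem_union_right _ (Finset.mem_filter.2
              ⟨(dir_mem hWF hve.1).1, e, hdis he, hve.1⟩)
          · exact Finset.mem_union_left _ (hdis (Finset.mem_of_mem_erase hv))
        · rcases Finset.mem_insert.1 hv with rfl | hv
          · exact le_rfl
          rcases Finset.mem_union.1 (hmbU hv) with h | h
          · exact hmax v h
          · exact absurd h (Finset.disjoint_left.1 hWF.1 hvV)
      · rw [Function.update_of_ne hdm]
        obtain ⟨h0, h1, h2⟩ := hk d (by rw [hVA]; exact Finset.mem_erase.2 ⟨hdm, hd⟩)
        have hdis : dis (induce G (A.erase m)) d ⊆ dis (induce G A) d :=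
          dis_mono (H := induce G (A.erase m)) (H' := induce G A)
            (Finset.inter_subset_inter_left (Finset.erase_subset m A))
            (fun a b h => ⟨h.1, Finset.mem_of_mem_erase h.2.1, Finset.mem_of_mem_erase h.2.2⟩) d
        exact ⟨h0, h1, h2.mono
          (Finset.filter_subset_filter _ (Finset.union_subset_union hdis (paS_mono hdis)))⟩
    · rw [hkm x, ← hsumA₀, hkq x, hVA, ← Finset.mul_prod_erase _ _ hm, Function.update_self]
      congr 1
      refine Finset.prod_congr rfl fun d hd => ?_
      rw [Function.update_of_ne (Finset.ne_of_mem_erase hd)]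

theorem pcf_of_pcl [Fintype Vt] {ord : Vt → ℕ} (hWF : G.WF) (htopo : IsTopo G ord)
    (hq : IsKernel G.V G.W q) (hl : Pcl G ord q) : Pcf G q := by
  intro A hA
  obtain ⟨k, hk, hkq⟩ := exists_conditional_factorization hWF htopo hq hl A hA
  have hsymm := induce_bi_symm (N := A) hWF
  refine ⟨fun D x => ∏ d ∈ D, k d x, fun D hD => ?_, fun x => ?_⟩
  · obtain ⟨v, -, rfl⟩ := Finset.mem_image.1 hD
    set D := dis (induce G A) v with hDdef
    have hDV : ∀ d ∈ D, d ∈ G.V ∩ A := fun d hd => (Finset.mem_filter.1 hd).1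
    have hdep : ∀ d ∈ D, DepOn (k d) ((D ∪ paS G D).filter fun v => v ∈ G.V → ord v ≤ ord d) := by
      intro d hd
      have := (hk d (hDV d hd)).2.2
      rwa [dis_eq_of_mem hsymm hd] at this
    refine ⟨fun x => Finset.prod_nonneg fun d hd => (hk d (hDV d hd)).1 x, ?_, ?_⟩
    · refine DepOn.prod fun d hd => (hdep d hd).mono fun w hw => ?_
      rw [Finset.union_sdiff_self_eq_union]
      exact (Finset.mem_filter.1 hw).1
    · refine sumOver_prod_eq_one ord htopo.1 D hdep (fun d hd w hw => ?_)
        fun d hd => (hk d (hDV d hd)).2.1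
      obtain ⟨hw, hwD⟩ := Finset.mem_inter.1 hw
      exact (Finset.mem_filter.1 hw).2 (Finset.mem_inter.1 (hDV w hwD)).1
  · rw [hkq x]
    change ∏ d ∈ (induce G A).V, k d x = _
    rw [← Finset.prod_fiberwise_of_maps_to (g := dis (induce G A)) (t := districts (induce G A))
      fun d hd => Finset.mem_image_of_mem _ hd]
    refine Finset.prod_congr rfl fun D hD => ?_
    obtain ⟨v, -, rfl⟩ := Finset.mem_image.1 hD
    refine Finset.prod_congr ?_ fun _ _ => rfl
    ext d
    rw [Finset.mem_filter]
    constructor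
    · rintro ⟨hd, h⟩
      rw [← h]
      exact Finset.mem_filter.2 ⟨hd, .refl⟩
    · exact fun hd => ⟨(Finset.mem_filter.1 hd).1, dis_eq_of_mem hsymm hd⟩

end Equivalence

end Nested

open Nested in
/-- for any CADMG `𝒢(V,W)` and topological ordering `≺`, the four
sets of kernels coincide: `𝒫^c_f(𝒢) = 𝒫^c_l(𝒢,≺) = 𝒫^c_m(𝒢) = 𝒫^c_a(𝒢)`. -/
theorem cadmg_markov_equivalence
    {Vt : Type} [Fintype Vt] [DecidableEq Vt]
    {𝔛 : Vt → Type} [∀ v, Fintype (𝔛 v)]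
    (G : PreCADMG Vt) (hWF : G.WF)
    (ord : Vt → ℕ) (htopo : IsTopo G ord) :
    ({q : (∀ v, 𝔛 v) → ℝ | IsKernel G.V G.W q ∧ Pcf G q}
        = {q : (∀ v, 𝔛 v) → ℝ | IsKernel G.V G.W q ∧ Pcl G ord q}) ∧
    ({q : (∀ v, 𝔛 v) → ℝ | IsKernel G.V G.W q ∧ Pcl G ord q}
        = {q : (∀ v, 𝔛 v) → ℝ | IsKernel G.V G.W q ∧ Pcm G q}) ∧
    ({q : (∀ v, 𝔛 v) → ℝ | IsKernel G.V G.W q ∧ Pcm G q}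
        = {q : (∀ v, 𝔛 v) → ℝ | IsKernel G.V G.W q ∧ Pca G q}) := by
  refine ⟨Set.ext fun q => and_congr_right fun hq => ⟨fun h => ?_, pcf_of_pcl hWF htopo hq⟩,
    Set.ext fun q => and_congr_right fun hq => ⟨fun h => ?_, pcl_of_pcm hWF htopo⟩,
    Set.ext fun q => and_congr_right fun hq => ⟨fun h => ?_, pcm_of_pca⟩⟩
  · exact pcl_of_pcm hWF htopo (pcm_of_pca (pca_of_pcf hWF h))
  · exact pcm_of_pca (pca_of_pcf hWF (pcf_of_pcl hWF htopo hq h))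
  · exact pca_of_pcf hWF (pcf_of_pcl hWF htopo hq (pcl_of_pcm hWF htopo h))
end
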